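/- arXiv:2201.09835 — 3 statements merged into one kernel-verified Lean document; each statement's English description precedes it below -/
import Mathlib

section
/- Let G be a finite simple graph with at least one edge. Then the symmetric edge polytope P_G is simple if and only if the graph obtained from G by deleting all isolated vertices is isomorphic to one of the following five graphs: a single edge P_1; the disjoint union 2P_1 of two edges; the path P_2 with two edges; the 3-cycle C_3; the 4-cycle C_4. -/
open SimpleGraph Finset Filter

namespace SEP

/-- The vector `e_i - e_j` in `ℝ^n`. -/
def eVec {n : ℕ} (i j : Fin n) : Fin n → ℝ :=
  fun t => (if t = i then 1 else 0) - (if t = j then 1 else 0)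

/-- The symmetric edge polytope of a graph on `Fin n`. -/
def symEdgePolytope {n : ℕ} (G : SimpleGraph (Fin n)) : Set (Fin n → ℝ) :=
  convexHull ℝ {x | ∃ i j, G.Adj i j ∧ x = eVec i j}

/-- Both darts `a` and `b` are arcs of a common directed cycle of length `m` of `G`. -/
def dartsInCycle {V : Type*} (G : SimpleGraph V) (a b : G.Dart) (m : ℕ) : Prop :=
  ∃ (u : V) (w : G.Walk u u), w.IsCycle ∧ w.length = m ∧ a ∈ w.darts ∧ b ∈ w.darts

/-- `F` is a face of the polytope `P`: the set of maximizers of some linear functional. -/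
def IsFaceOfPolytope {n : ℕ} (P F : Set (Fin n → ℝ)) : Prop :=
  ∃ a : Fin n → ℝ,
    F = {x | x ∈ P ∧ ∀ y ∈ P, ∑ t, a t * y t ≤ ∑ t, a t * x t}

/-- Dimension of (the affine span of) a subset of `ℝ^n`. -/
noncomputable def polyDim {n : ℕ} (s : Set (Fin n → ℝ)) : ℕ :=
  Module.finrank ℝ (vectorSpan ℝ s)

/-- `v` is a vertex of the polytope `P`. -/
def IsVertexOfPolytope {n : ℕ} (P : Set (Fin n → ℝ)) (v : Fin n → ℝ) : Prop :=
  IsFaceOfPolytope P {v}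

/-- `F` is an edge (a 1-dimensional face) of the polytope `P`. -/
def IsEdgeOfPolytope {n : ℕ} (P F : Set (Fin n → ℝ)) : Prop :=
  IsFaceOfPolytope P F ∧ polyDim F = 1

/-- A polytope is simple if every vertex lies on exactly `dim P` edges. -/
def IsSimplePolytope {n : ℕ} (P : Set (Fin n → ℝ)) : Prop :=
  ∀ v, IsVertexOfPolytope P v →
    Set.ncard {F : Set (Fin n → ℝ) | IsEdgeOfPolytope P F ∧ v ∈ F} = polyDim P

/-- Two disjoint edges, on four vertices. -/
def twoDisjointEdges : SimpleGraph (Fin 4) :=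
  SimpleGraph.fromEdgeSet {s(0, 1), s(2, 3)}

/-- The cyclomatic number `|E| - |V| + c` of a graph, as an integer. -/
noncomputable def cyc {V : Type*} (G : SimpleGraph V) : ℤ :=
  (G.edgeSet.ncard : ℤ) + Nat.card G.ConnectedComponent - Nat.card V

/-- A graph is 2-connected: connected, with at least 3 vertices, and deleting any
single vertex leaves it connected. -/
def TwoConnected {V : Type*} (G : SimpleGraph V) : Prop :=
  G.Connected ∧ 3 ≤ Nat.card V ∧ ∀ v : V, (G.induce {u | u ≠ v}).Connected

/-- The subgraph `H` consists of a single edge of `G`. -/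
def IsSingleEdge {V : Type*} (G : SimpleGraph V) (H : G.Subgraph) : Prop :=
  ∃ (u v : V) (h : G.Adj u v), H = G.subgraphOfAdj h

/-- `H` is a 2-connected component (block) of `G`: an inclusion-maximal subgraph that is
2-connected or a single edge. -/
def IsBlock {V : Type*} (G : SimpleGraph V) (H : G.Subgraph) : Prop :=
  (TwoConnected H.coe ∨ IsSingleEdge G H) ∧
    ∀ H' : G.Subgraph, H ≤ H' → (TwoConnected H'.coe ∨ IsSingleEdge G H') → H' = H

/-- A pair of darts (oriented edges) of `G`, with distinct underlying edges, is *bad*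
with respect to the order `elt` on edges. -/
def BadPair {V : Type*} (G : SimpleGraph V) (elt : Sym2 V → Sym2 V → Prop)
    (a b : G.Dart) : Prop :=
  a.edge ≠ b.edge ∧
    (dartsInCycle G a b 3 ∨
      ∃ (u : V) (w : G.Walk u u), w.IsCycle ∧ w.length = 4 ∧ a ∈ w.darts ∧ b ∈ w.darts ∧
        (∃ e ∈ w.edges, elt e a.edge) ∧ (∃ e ∈ w.edges, elt e b.edge))

/-- `n₁(G, <)`: the number of (unordered) bad pairs of oriented edges. -/
noncomputable def n1 {V : Type*} (G : SimpleGraph V) (elt : Sym2 V → Sym2 V → Prop) : ℕ :=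
  Set.ncard {z : Sym2 G.Dart | ∃ a b, BadPair G elt a b ∧ z = s(a, b)}

/-- `γ₂(G, <) = 2 cy(G)(cy(G)+2) - n₁(G, <)`. -/
noncomputable def gammaTwo {V : Type*} (G : SimpleGraph V)
    (elt : Sym2 V → Sym2 V → Prop) : ℤ :=
  2 * cyc G * (cyc G + 2) - (n1 G elt : ℤ)

/-- Restriction of an order on `Sym2 V` to `Sym2 s` for `s : Set V`. -/
def restrictOrd {V : Type*} (elt : Sym2 V → Sym2 V → Prop) (s : Set V) :
    Sym2 s → Sym2 s → Prop :=
  fun e₁ e₂ => elt (e₁.map Subtype.val) (e₂.map Subtype.val)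

/-- The graph `G_n` on `Fin n`: vertices `0` and `1` are adjacent to everything. -/
def GnGraph (n : ℕ) : SimpleGraph (Fin n) :=
  SimpleGraph.fromRel (fun a _ => a.val < 2)

/-- The complete bipartite graph `K_{2, n-2}` on `Fin n`, with parts `{0,1}` and the rest. -/
def K2Graph (n : ℕ) : SimpleGraph (Fin n) :=
  SimpleGraph.fromRel (fun a b => a.val < 2 ∧ 2 ≤ b.val)

/-- A set `S` of darts of `G` is a face of the triangulation `Δ_<` of `∂P_G`. -/
def IsFace {V : Type*} (G : SimpleGraph V) (elt : Sym2 V → Sym2 V → Prop)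
    (S : Set G.Dart) : Prop :=
  (¬ ∃ d ∈ S, d.symm ∈ S) ∧
    ∀ ℓ : ℕ, 2 ≤ ℓ → ∀ (u : V) (w : G.Walk u u), w.IsCycle →
      (w.length = 2 * ℓ - 1 → Set.ncard {d ∈ S | d ∈ w.darts} < ℓ) ∧
      (w.length = 2 * ℓ →
        Set.ncard {d ∈ S | d ∈ w.darts ∧ ∃ e ∈ w.edges, elt e d.edge} < ℓ)

/-- The face complex `Δ_<` of `(G, <)`. -/
def faceCx {V : Type*} (G : SimpleGraph V) (elt : Sym2 V → Sym2 V → Prop) :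
    Set (Set G.Dart) :=
  {S | IsFace G elt S}

/-- The join of two simplicial complexes (given as families of faces on disjoint
vertex types). -/
def joinCx {A B : Type*} (F : Set (Set A)) (H : Set (Set B)) : Set (Set (A ⊕ B)) :=
  {S | ∃ F₁ ∈ F, ∃ H₁ ∈ H, S = Sum.inl '' F₁ ∪ Sum.inr '' H₁}

/-- The complex consisting of two disjoint vertices. -/
def twoPtCx : Set (Set (Fin 2)) :=
  {S | S = ∅ ∨ S = {0} ∨ S = {1}}

/-- Contraction of the edge `{v, w}` of a simplicial complex; `v` is identified with `w`. -/
def contractCx {A : Type*} (F : Set (Set A)) (v w : A) : Set (Set A) :=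
  {S | (S ∈ F ∧ v ∉ S) ∨ ∃ H ∈ F, v ∈ H ∧ S = (H \ {v}) ∪ {w}}

/-- Isomorphism of simplicial complexes: a bijection of vertex sets inducing a bijection
of faces. -/
def CxIso {A B : Type*} (F : Set (Set A)) (H : Set (Set B)) : Prop :=
  ∃ φ : A → B, Set.BijOn φ (⋃₀ F) (⋃₀ H) ∧
    (∀ S ∈ F, φ '' S ∈ H) ∧ (∀ T ∈ H, ∃ S ∈ F, φ '' S = T)

/-! ### Erdős–Rényi random graphs -/

/-- The probability weight of a fixed graph `G` in the Erdős–Rényi model `G(n,p)`. -/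
noncomputable def graphWeight (n : ℕ) (p : ℝ) (G : SimpleGraph (Fin n)) : ℝ :=
  p ^ G.edgeSet.ncard * (1 - p) ^ (n.choose 2 - G.edgeSet.ncard)

/-- The probability of an event `A` in the Erdős–Rényi model `G(n,p)`. -/
noncomputable def erProb (n : ℕ) (p : ℝ) (A : Set (SimpleGraph (Fin n))) : ℝ :=
  ∑ G : SimpleGraph (Fin n), A.indicator (graphWeight n p) G

/-- The expectation of a random variable in the Erdős–Rényi model `G(n,p)`. -/
noncomputable def erExp (n : ℕ) (p : ℝ) (X : SimpleGraph (Fin n) → ℝ) : ℝ :=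
  ∑ G : SimpleGraph (Fin n), graphWeight n p G * X G

/-- The variance of a random variable in the Erdős–Rényi model `G(n,p)`. -/
noncomputable def erVar (n : ℕ) (p : ℝ) (X : SimpleGraph (Fin n) → ℝ) : ℝ :=
  erExp n p (fun G => (X G - erExp n p X) ^ 2)

/-- The number of cycles of `G` with exactly `k` vertices, counted via their edge sets. -/
noncomputable def numCycles {V : Type*} (G : SimpleGraph V) (k : ℕ) : ℕ :=
  Set.ncard {s : Set (Sym2 V) |
    ∃ (u : V) (w : G.Walk u u), w.IsCycle ∧ w.length = k ∧ s = {e | e ∈ w.edges}}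

/-- `E(X_k) = C(n,k)·((k−1)!/2)·p^k`, the expected number of `k`-cycles. -/
noncomputable def expCycles (n : ℕ) (p : ℝ) (k : ℕ) : ℝ :=
  (n.choose k : ℝ) * ((Nat.factorial (k - 1) : ℝ) / 2) * p ^ k

/-- `E(X_E) = C(n,2)·p`, the expected number of edges. -/
noncomputable def expEdges (n : ℕ) (p : ℝ) : ℝ :=
  (n.choose 2 : ℝ) * p

/-- `n_{k-1}(G)`: the number of `k`-element non-faces of `Δ_<` containing no antipodal
pair. -/
noncomputable def numNonFaces {V : Type*} (G : SimpleGraph V)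
    (elt : Sym2 V → Sym2 V → Prop) (k : ℕ) : ℕ :=
  Set.ncard {S : Set G.Dart |
    S.ncard = k ∧ (¬ ∃ d ∈ S, d.symm ∈ S) ∧ ¬ IsFace G elt S}

/-- `f_{k-1}(G)`: the number of `k`-element faces of `Δ_<`. -/
noncomputable def numFaces {V : Type*} (G : SimpleGraph V)
    (elt : Sym2 V → Sym2 V → Prop) (k : ℕ) : ℕ :=
  Set.ncard {S : Set G.Dart | S.ncard = k ∧ IsFace G elt S}

/-- The generalized binomial coefficient `binom(x, ℓ)` for real `x`. -/
noncomputable def realChoose (x : ℝ) (ℓ : ℕ) : ℝ :=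
  (∏ i ∈ Finset.range ℓ, (x - i)) / (Nat.factorial ℓ)

/-- The recursively defined γ-numbers `γ_ℓ(G)`:
`γ_0 = 1` and
`γ_ℓ = f_{ℓ−1} − [t^{n−1−ℓ}] ∑_{i<ℓ} γ_i (t+1)^i (t+2)^{n−1−2i}`. -/
noncomputable def gammaRG (n : ℕ) (G : SimpleGraph (Fin n))
    (elt : Sym2 (Fin n) → Sym2 (Fin n) → Prop) : ℕ → ℤ := fun ℓ =>
  Nat.strongRecOn ℓ (fun ℓ ih =>
    if ℓ = 0 then (1 : ℤ)
    else
      (numFaces G elt ℓ : ℤ) -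
        Polynomial.coeff
          (∑ i ∈ (Finset.range ℓ).attach,
            Polynomial.C (ih i.1 (Finset.mem_range.mp i.2)) *
              ((Polynomial.X + 1) ^ (i.1 : ℕ) *
                (Polynomial.X + 2) ^ (n - 1 - 2 * i.1) : Polynomial ℤ))
          (n - 1 - ℓ))

open Matrix

theorem sum_mul_eVec {n : ℕ} (a : Fin n → ℝ) (i j : Fin n) :
    ∑ t, a t * eVec i j t = a i - a j := by
  simp [eVec, mul_sub, Finset.sum_sub_distrib]

theorem neg_eVec {n : ℕ} (i j : Fin n) : -eVec i j = eVec j i := by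
  funext t; simp [eVec]

theorem eVec_add_eVec {n : ℕ} (i j k : Fin n) : eVec i j + eVec j k = eVec i k := by
  funext t; simp [eVec]

theorem eVec_apply_left {n : ℕ} {i j : Fin n} (h : i ≠ j) : eVec i j i = 1 := by
  simp [eVec, h]

theorem eVec_apply_right {n : ℕ} {i j : Fin n} (h : i ≠ j) : eVec i j j = -1 := by
  simp [eVec, h.symm]

theorem eVec_inj {n : ℕ} {i j k l : Fin n} (hij : i ≠ j) (h : eVec i j = eVec k l) :
    i = k ∧ j = l := by
  have h1 := congrFun h i
  have h2 := congrFun h j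
  rw [eVec_apply_left hij] at h1
  rw [eVec_apply_right hij] at h2
  simp only [eVec] at h1 h2
  constructor
  · by_contra hne
    rw [if_neg hne] at h1
    split_ifs at h1 <;> norm_num at h1
  · by_contra hne
    rw [if_neg hne] at h2
    split_ifs at h2 <;> norm_num at h2

theorem eVec_dotProduct_self {n : ℕ} {i j : Fin n} (h : i ≠ j) :
    eVec i j ⬝ᵥ eVec i j = 2 := by
  have := sum_mul_eVec (eVec i j) i j
  rw [eVec_apply_left h, eVec_apply_right h] at this
  rw [dotProduct, this]; norm_num

/-- The generators `e_i - e_j` of the symmetric edge polytope. -/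
def arcVecs {n : ℕ} (G : SimpleGraph (Fin n)) : Set (Fin n → ℝ) :=
  {x | ∃ i j, G.Adj i j ∧ x = eVec i j}

theorem arcVecs_finite {n : ℕ} (G : SimpleGraph (Fin n)) : (arcVecs G).Finite := by
  refine (Set.finite_range (fun p : Fin n × Fin n => eVec p.1 p.2)).subset ?_
  rintro _ ⟨i, j, -, rfl⟩
  exact ⟨(i, j), rfl⟩

theorem neg_mem_arcVecs {n : ℕ} {G : SimpleGraph (Fin n)} {x : Fin n → ℝ}
    (hx : x ∈ arcVecs G) : -x ∈ arcVecs G := by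
  obtain ⟨i, j, h, rfl⟩ := hx
  exact ⟨j, i, h.symm, neg_eVec i j⟩

theorem dotProduct_self_of_mem_arcVecs {n : ℕ} {G : SimpleGraph (Fin n)} {x : Fin n → ℝ}
    (hx : x ∈ arcVecs G) : x ⬝ᵥ x = 2 := by
  obtain ⟨i, j, h, rfl⟩ := hx
  exact eVec_dotProduct_self h.ne

theorem dotProduct_eq_of_mem_convexHull {n : ℕ} {S : Set (Fin n → ℝ)} {a x : Fin n → ℝ} {M : ℝ}
    (h : ∀ g ∈ S, a ⬝ᵥ g = M) (hx : x ∈ convexHull ℝ S) : a ⬝ᵥ x = M := by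
  have : convexHull ℝ S ⊆ {x | a ⬝ᵥ x = M} := by
    refine convexHull_min h ?_
    intro x hx y hy s t hs ht hst
    simp only [Set.mem_ofPred_eq] at hx hy ⊢
    rw [dotProduct_add, dotProduct_smul, dotProduct_smul, hx, hy, ← add_smul, hst, one_smul]
  exact this hx

/-- The face of a convex hull on which a functional is maximal is spanned by the maximizing
generators. -/
theorem maximizers_convexHull {n : ℕ} (A : Set (Fin n → ℝ)) (a : Fin n → ℝ) (M : ℝ)
    (hle : ∀ g ∈ A, ∑ t, a t * g t ≤ M) (hex : ∃ g ∈ A, ∑ t, a t * g t = M) :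
    {x | x ∈ convexHull ℝ A ∧ ∀ y ∈ convexHull ℝ A, ∑ t, a t * y t ≤ ∑ t, a t * x t} =
      convexHull ℝ {g | g ∈ A ∧ ∑ t, a t * g t = M} := by
  change ∀ g ∈ A, a ⬝ᵥ g ≤ M at hle
  change ∃ g ∈ A, a ⬝ᵥ g = M at hex
  change {x | x ∈ convexHull ℝ A ∧ ∀ y ∈ convexHull ℝ A, a ⬝ᵥ y ≤ a ⬝ᵥ x} =
      convexHull ℝ {g | g ∈ A ∧ a ⬝ᵥ g = M}
  have key : convexHull ℝ A ⊆
      {x | a ⬝ᵥ x ≤ M ∧ (a ⬝ᵥ x = M → x ∈ convexHull ℝ {g | g ∈ A ∧ a ⬝ᵥ g = M})} := by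
    refine convexHull_min (fun g hg => ⟨hle g hg, fun h => subset_convexHull ℝ _ ⟨hg, h⟩⟩) ?_
    rw [convex_iff_forall_pos]
    rintro x ⟨hx, hx'⟩ y ⟨hy, hy'⟩ s t hs ht hst
    have e : a ⬝ᵥ (s • x + t • y) = s * (a ⬝ᵥ x) + t * (a ⬝ᵥ y) := by
      simp [dotProduct_add, dotProduct_smul]
    have hsx := mul_le_mul_of_nonneg_left hx hs.le
    have hty := mul_le_mul_of_nonneg_left hy ht.le
    have hM : s * M + t * M = M := by rw [← add_mul, hst, one_mul]
    refine ⟨by rw [e]; linarith, fun h => ?_⟩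
    · rw [e] at h
      have h1 : a ⬝ᵥ x = M := mul_left_cancel₀ hs.ne' (by linarith)
      have h2 : a ⬝ᵥ y = M := mul_left_cancel₀ ht.ne' (by linarith)
      exact convex_convexHull ℝ _ (hx' h1) (hy' h2) hs.le ht.le hst
  obtain ⟨g, hg, hgM⟩ := hex
  ext x
  constructor
  · rintro ⟨hx, hmax⟩
    refine (key hx).2 (le_antisymm (key hx).1 ?_)
    rw [← hgM]; exact hmax g (subset_convexHull ℝ _ hg)
  · intro hx
    refine ⟨convexHull_mono (fun _ h => h.1) hx, fun y hy => ?_⟩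
    have : a ⬝ᵥ x = M := dotProduct_eq_of_mem_convexHull (fun g hg => hg.2) hx
    rw [this]; exact (key hy).1

/-- Every face of a symmetric edge polytope is spanned by the generators maximizing some
functional. -/
theorem IsFaceOfPolytope.exists_eq_convexHull {n : ℕ} {G : SimpleGraph (Fin n)}
    (hA : (arcVecs G).Nonempty) {F : Set (Fin n → ℝ)}
    (hF : IsFaceOfPolytope (symEdgePolytope G) F) :
    ∃ (a : Fin n → ℝ) (M : ℝ), (∀ i j, G.Adj i j → a i - a j ≤ M) ∧
      (∃ g ∈ arcVecs G, ∑ t, a t * g t = M) ∧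
      F = convexHull ℝ {g | g ∈ arcVecs G ∧ ∑ t, a t * g t = M} := by
  obtain ⟨a, rfl⟩ := hF
  obtain ⟨g, hg, hmax⟩ := (arcVecs_finite G).exists_maximalFor (fun x => ∑ t, a t * x t) _ hA
  have hle : ∀ y ∈ arcVecs G, ∑ t, a t * y t ≤ ∑ t, a t * g t := by
    intro y hy
    rcases le_total (∑ t, a t * y t) (∑ t, a t * g t) with h | h
    · exact h
    · exact hmax hy h
  refine ⟨a, ∑ t, a t * g t, ?_, ⟨g, hg, rfl⟩, ?_⟩
  · intro i j h
    rw [← sum_mul_eVec]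
    exact hle _ ⟨i, j, h, rfl⟩
  · exact maximizers_convexHull _ a _ hle ⟨g, hg, rfl⟩

theorem isFaceOfPolytope_of_maximizers {n : ℕ} {G : SimpleGraph (Fin n)} {T : Set (Fin n → ℝ)}
    (a : Fin n → ℝ) (M : ℝ) (hT : T.Nonempty)
    (hle : ∀ i j, G.Adj i j → a i - a j ≤ M)
    (hiff : ∀ g, g ∈ arcVecs G ∧ ∑ t, a t * g t = M ↔ g ∈ T) :
    IsFaceOfPolytope (symEdgePolytope G) (convexHull ℝ T) := by
  refine ⟨a, ?_⟩
  obtain ⟨g, hg⟩ := hT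
  have := maximizers_convexHull (arcVecs G) a M
    (by rintro _ ⟨i, j, h, rfl⟩; rw [sum_mul_eVec]; exact hle i j h) ⟨g, (hiff g).2 hg⟩
  have hT' : T = {g | g ∈ arcVecs G ∧ ∑ t, a t * g t = M} := by ext g; exact (hiff g).symm
  rw [hT', ← this]; rfl

theorem polyDim_convexHull {n : ℕ} (s : Set (Fin n → ℝ)) :
    polyDim (convexHull ℝ s) = polyDim s := by
  unfold polyDim
  rw [← direction_affineSpan, affineSpan_convexHull, direction_affineSpan]

theorem polyDim_symEdgePolytope {n : ℕ} (G : SimpleGraph (Fin n)) :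
    polyDim (symEdgePolytope G) = Module.finrank ℝ (Submodule.span ℝ (arcVecs G)) := by
  have : polyDim (symEdgePolytope G) = polyDim (arcVecs G) := polyDim_convexHull _
  suffices h : vectorSpan ℝ (arcVecs G) = Submodule.span ℝ (arcVecs G) by
    rw [this, polyDim, h]
  apply le_antisymm
  · refine Submodule.span_le.2 ?_
    rintro _ ⟨x, hx, y, hy, rfl⟩
    exact sub_mem (Submodule.subset_span hx) (Submodule.subset_span hy)
  · refine Submodule.span_le.2 fun x hx => ?_
    have h := vsub_mem_vectorSpan ℝ hx (neg_mem_arcVecs hx)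
    have h2 := Submodule.smul_mem _ (1 / 2 : ℝ) h
    have e : (1 / 2 : ℝ) • (x -ᵥ -x) = x := by
      simp only [vsub_eq_sub]; module
    rwa [e] at h2

/-- A line contains at most two points of a sphere. -/
theorem eq_or_eq_of_sub_eq_smul {n : ℕ} {x y z : Fin n → ℝ} {r t : ℝ} (hx : x ⬝ᵥ x = r)
    (hy : y ⬝ᵥ y = r) (hz : z ⬝ᵥ z = r) (hxy : x ≠ y) (h : z - x = t • (y - x)) :
    z = x ∨ z = y := by
  have hz' : z = x + t • (y - x) := by rw [← h]; abel
  have hc : y ⬝ᵥ x = x ⬝ᵥ y := dotProduct_comm _ _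
  have hne : (y - x) ⬝ᵥ (y - x) ≠ 0 := by
    rw [Ne, dotProduct_self_eq_zero, sub_eq_zero]; exact hxy.symm
  have e1 : (y - x) ⬝ᵥ (y - x) = 2 * r - 2 * (x ⬝ᵥ y) := by
    simp only [dotProduct_sub, sub_dotProduct, hx, hy, hc]; ring
  rw [e1] at hne
  have e2 : t * (t - 1) * (2 * r - 2 * (x ⬝ᵥ y)) = 0 := by
    rw [hz'] at hz
    simp only [dotProduct_sub, sub_dotProduct, hx, hy, hc, dotProduct_add, add_dotProduct,
      dotProduct_smul, smul_dotProduct, smul_eq_mul] at hz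
    linear_combination hz
  rcases mul_eq_zero.1 ((mul_eq_zero.1 e2).resolve_right hne) with h0 | h1
  · left; rw [hz', h0]; simp
  · right; rw [hz', sub_eq_zero.1 h1]; simp

theorem eq_or_eq_of_polyDim_eq_one {n : ℕ} {G : SimpleGraph (Fin n)} {F : Set (Fin n → ℝ)}
    (hF : polyDim F = 1) {x y z : Fin n → ℝ} (hx : x ∈ arcVecs G) (hy : y ∈ arcVecs G)
    (hz : z ∈ arcVecs G) (hxF : x ∈ F) (hyF : y ∈ F) (hzF : z ∈ F) (hxy : x ≠ y) :
    z = x ∨ z = y := by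
  have h1 := vsub_mem_vectorSpan ℝ hyF hxF
  have h2 := vsub_mem_vectorSpan ℝ hzF hxF
  have h0 : (⟨_, h1⟩ : vectorSpan ℝ F) ≠ 0 := by
    rw [Ne, Submodule.mk_eq_zero, vsub_eq_sub, sub_eq_zero]; exact hxy.symm
  obtain ⟨t, ht⟩ := (finrank_eq_one_iff_of_nonzero' _ h0).1 hF ⟨_, h2⟩
  exact eq_or_eq_of_sub_eq_smul (dotProduct_self_of_mem_arcVecs hx)
    (dotProduct_self_of_mem_arcVecs hy) (dotProduct_self_of_mem_arcVecs hz) hxy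
    (congrArg Subtype.val ht).symm

theorem polyDim_pair {n : ℕ} {x y : Fin n → ℝ} (h : x ≠ y) :
    polyDim (convexHull ℝ {x, y}) = 1 := by
  rw [polyDim_convexHull, polyDim, vectorSpan_pair_rev]
  exact finrank_span_singleton (by rwa [vsub_eq_sub, sub_ne_zero, ne_comm])


theorem polyDim_singleton {n : ℕ} (x : Fin n → ℝ) : polyDim {x} = 0 := by
  rw [polyDim, vectorSpan_singleton, finrank_bot]

/-- The arcs `i → j` and `k → l` lie on a common directed cycle of length `3` or `4`. -/
def BadArc {n : ℕ} (G : SimpleGraph (Fin n)) (i j k l : Fin n) : Prop :=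
  (j = k ∧ (G.Adj i l ∨ ∃ y, y ≠ j ∧ G.Adj i y ∧ G.Adj y l)) ∨
  (l = i ∧ (G.Adj k j ∨ ∃ y, y ≠ i ∧ G.Adj k y ∧ G.Adj y j)) ∨
  (i ≠ k ∧ j ≠ l ∧ G.Adj i l ∧ G.Adj k j)

/-- The functional `a` is maximized, among the arcs of `G`, exactly at `i → j` and `k → l`. -/
def Exposes {n : ℕ} (G : SimpleGraph (Fin n)) (a : Fin n → ℝ) (M : ℝ) (i j k l : Fin n) : Prop :=
  ∀ p q, G.Adj p q → a p - a q ≤ M ∧ (a p - a q = M ↔ (p = i ∧ q = j) ∨ (p = k ∧ q = l))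

theorem Exposes.swap {n : ℕ} {G : SimpleGraph (Fin n)} {a : Fin n → ℝ} {M : ℝ}
    {i j k l : Fin n} (h : Exposes G a M i j k l) : Exposes G a M k l i j :=
  fun p q hpq => ⟨(h p q hpq).1, (h p q hpq).2.trans or_comm⟩

theorem exists_exposes_path {n : ℕ} {G : SimpleGraph (Fin n)} {i j l : Fin n}
    (hij : G.Adj i j) (hjl : G.Adj j l) (hne : i ≠ l) (hil : ¬ G.Adj i l)
    (hy : ∀ y, y ≠ j → G.Adj i y → ¬ G.Adj y l) :
    ∃ a M, Exposes G a M i j j l := by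
  classical
  have h1 := hij.ne
  have h2 := hjl.ne
  refine ⟨fun t => if t = i then 1 else if t = j then 0 else if t = l then -1 else
    if G.Adj i t then 1 / 4 else if G.Adj t l then -1 / 4 else 0, 1, ?_⟩
  intro p q hpq
  have h3 := hpq.ne
  dsimp only
  by_cases hpi : p = i
  · subst hpi
    by_cases hqj : q = j
    · subst hqj; simp [h1, h1.symm]
    · have : q ≠ l := by rintro rfl; exact hil hpq
      simp only [if_true, if_neg h3.symm, if_neg hqj, if_neg this, if_pos hpq]
      norm_num [hqj, h1]
  by_cases hql : q = l
  · subst hql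
    by_cases hpj : p = j
    · subst hpj; simp [h1.symm, h2.symm, hne.symm]
    · have h4 : ¬ G.Adj i p := fun h => hy p hpj h hpq
      simp only [if_true, if_neg hpi, if_neg hpj, if_neg h3, if_neg h4, if_neg hne.symm,
        if_neg h2.symm, if_pos hpq]
      norm_num [hpi, hpj]
  simp only [hpi, hql, if_false, false_and, and_false, or_false, iff_false]
  split_ifs <;> norm_num

theorem exists_exposes_disjoint {n : ℕ} {G : SimpleGraph (Fin n)} {i j k l : Fin n}
    (hij : G.Adj i j) (hkl : G.Adj k l) (hik : i ≠ k) (hil : i ≠ l) (hjk : j ≠ k) (hjl : j ≠ l)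
    (h : ¬ G.Adj i l) : ∃ a M, Exposes G a M i j k l := by
  have h1 := hij.ne
  have h2 := hkl.ne
  refine ⟨fun t => if t = i then 1 else if t = j then 0 else if t = k then 1 / 2 else
    if t = l then -1 / 2 else 1 / 4, 1, ?_⟩
  intro p q hpq
  have h3 := hpq.ne
  dsimp only
  by_cases hpi : p = i
  · subst hpi
    have : q ≠ l := by rintro rfl; exact h hpq
    simp only [if_true, if_neg h3.symm, if_neg this, hik, true_and, false_and, or_false]
    split_ifs with h4 h5 <;> norm_num [h4]
  by_cases hql : q = l
  · subst hql
    split_ifs <;> grind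
  simp only [hpi, hql, if_false, false_and, and_false, or_false, iff_false]
  split_ifs <;> norm_num

theorem exists_exposes_of_not_badArc {n : ℕ} {G : SimpleGraph (Fin n)} {i j k l : Fin n}
    (hij : G.Adj i j) (hkl : G.Adj k l) (hrev : ¬ (k = j ∧ l = i)) (h : ¬ BadArc G i j k l) :
    ∃ a M, Exposes G a M i j k l := by
  have h1 := hij.ne
  have h2 := hkl.ne
  by_cases hik : i = k
  · subst hik
    refine ⟨fun t => if t = i then 1 else if t = j ∨ t = l then -1 else 0, 2, ?_⟩
    intro p q hpq
    have h3 := hpq.ne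
    dsimp only
    split_ifs <;> grind
  by_cases hjl : j = l
  · subst hjl
    refine ⟨fun t => if t = j then -1 else if t = i ∨ t = k then 1 else 0, 2, ?_⟩
    intro p q hpq
    have h3 := hpq.ne
    dsimp only
    split_ifs <;> grind
  simp only [BadArc, not_or, not_and, not_exists] at h
  obtain ⟨ha, hb, hc⟩ := h
  by_cases hjk : j = k
  · subst hjk
    exact exists_exposes_path hij hkl (fun h => hrev ⟨rfl, h.symm⟩) (ha rfl).1 (ha rfl).2
  by_cases hli : l = i
  · subst hli
    obtain ⟨a, M, h⟩ := exists_exposes_path hkl hij (fun h => hrev ⟨h, rfl⟩) (hb rfl).1 (hb rfl).2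
    exact ⟨a, M, h.swap⟩
  by_cases hil : G.Adj i l
  · obtain ⟨a, M, h⟩ := exists_exposes_disjoint hkl hij (Ne.symm hik) (Ne.symm hjk) hli
      (Ne.symm hjl) (hc hik hjl hil)
    exact ⟨a, M, h.swap⟩
  · exact exists_exposes_disjoint hij hkl hik (Ne.symm hli) hjk hjl hil

/-- The arc `k → l` spans an edge of the symmetric edge polytope together with `i → j`. -/
def GoodArc {n : ℕ} (G : SimpleGraph (Fin n)) (i j k l : Fin n) : Prop :=
  G.Adj k l ∧ ¬ (k = i ∧ l = j) ∧ ¬ (k = j ∧ l = i) ∧ ¬ BadArc G i j k l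

/-- The generators of the symmetric edge polytope joined by an edge to `e_i - e_j`. -/
def goodVecs {n : ℕ} (G : SimpleGraph (Fin n)) (i j : Fin n) : Set (Fin n → ℝ) :=
  {x | ∃ k l, GoodArc G i j k l ∧ x = eVec k l}

theorem Exposes.isFaceOfPolytope {n : ℕ} {G : SimpleGraph (Fin n)} {a : Fin n → ℝ} {M : ℝ}
    {i j k l : Fin n} (h : Exposes G a M i j k l) (hij : G.Adj i j) (hkl : G.Adj k l) :
    IsFaceOfPolytope (symEdgePolytope G) (convexHull ℝ {eVec i j, eVec k l}) := by
  refine isFaceOfPolytope_of_maximizers a M ⟨_, Or.inl rfl⟩ (fun p q hpq => (h p q hpq).1) ?_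
  intro g
  constructor
  · rintro ⟨⟨p, q, hpq, rfl⟩, hM⟩
    rw [sum_mul_eVec] at hM
    rcases (h p q hpq).2.1 hM with ⟨rfl, rfl⟩ | ⟨rfl, rfl⟩
    · exact Or.inl rfl
    · exact Or.inr rfl
  · rintro (rfl | rfl)
    · exact ⟨⟨i, j, hij, rfl⟩, by rw [sum_mul_eVec]; exact (h i j hij).2.2 (Or.inl ⟨rfl, rfl⟩)⟩
    · exact ⟨⟨k, l, hkl, rfl⟩, by rw [sum_mul_eVec]; exact (h k l hkl).2.2 (Or.inr ⟨rfl, rfl⟩)⟩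

theorem isVertexOfPolytope_eVec {n : ℕ} {G : SimpleGraph (Fin n)} {i j : Fin n}
    (hij : G.Adj i j) : IsVertexOfPolytope (symEdgePolytope G) (eVec i j) := by
  have hne := hij.ne
  have : Exposes G (fun t => if t = i then 1 else if t = j then -1 else 0) 2 i j i j := by
    intro p q hpq
    have h3 := hpq.ne
    dsimp only
    split_ifs <;> grind
  simpa [IsVertexOfPolytope] using this.isFaceOfPolytope hij hij

theorem IsVertexOfPolytope.mem_arcVecs {n : ℕ} {G : SimpleGraph (Fin n)}
    (hA : (arcVecs G).Nonempty) {v : Fin n → ℝ}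
    (hv : IsVertexOfPolytope (symEdgePolytope G) v) : v ∈ arcVecs G := by
  obtain ⟨a, M, -, ⟨g, hg, hgM⟩, hF⟩ := IsFaceOfPolytope.exists_eq_convexHull hA hv
  have : g ∈ ({v} : Set (Fin n → ℝ)) := by
    rw [hF]; exact subset_convexHull ℝ _ ⟨hg, hgM⟩
  rwa [← Set.mem_singleton_iff.1 this]

theorem eVec_ne_neg {n : ℕ} {i j k l : Fin n} (hij : i ≠ j) (h : ¬ (k = j ∧ l = i)) :
    eVec k l ≠ -eVec i j := by
  rw [neg_eVec]
  intro h'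
  obtain ⟨h1, h2⟩ := eVec_inj hij.symm h'.symm
  exact h ⟨h1.symm, h2.symm⟩

/-- If a functional is maximal on two arcs of a common directed cycle of length `3` or `4`,
then it is maximal on a third arc or it vanishes on the polytope. -/
theorem BadArc.exists_third {n : ℕ} {G : SimpleGraph (Fin n)} {i j k l : Fin n}
    (hb : BadArc G i j k l) (hij : G.Adj i j) (hkl : G.Adj k l)
    (hne : ¬ (k = i ∧ l = j)) (hrev : ¬ (k = j ∧ l = i)) {a : Fin n → ℝ} {M : ℝ}
    (hle : ∀ p q, G.Adj p q → a p - a q ≤ M) (h1 : a i - a j = M) (h2 : a k - a l = M) :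
    M ≤ 0 ∨ ∃ p q, G.Adj p q ∧ a p - a q = M ∧ ¬ (p = i ∧ q = j) ∧ ¬ (p = k ∧ q = l) := by
  rcases hb with ⟨rfl, h | ⟨y, hy, h3, h4⟩⟩ | ⟨rfl, h | ⟨y, hy, h3, h4⟩⟩ | ⟨hik, hjl, h3, h4⟩
  · left; have := hle _ _ h; linarith
  · right
    have h5 := hle _ _ h3
    have h6 := hle _ _ h4
    exact ⟨i, y, h3, by linarith, fun h => hy h.2, fun h => hij.ne h.1⟩
  · left; have := hle _ _ h; linarith
  · right
    have h5 := hle _ _ h3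
    have h6 := hle _ _ h4
    exact ⟨k, y, h3, by linarith, fun h => hkl.ne h.1, fun h => hy h.2⟩
  · right
    have h5 := hle _ _ h3
    have h6 := hle _ _ h4
    exact ⟨i, l, h3, by linarith, fun h => hjl h.2.symm, fun h => hik h.1⟩

theorem setOf_isEdgeOfPolytope_eq {n : ℕ} {G : SimpleGraph (Fin n)} {i j : Fin n}
    (hij : G.Adj i j) (hw : ∃ w ∈ arcVecs G, w ≠ eVec i j ∧ w ≠ -eVec i j) :
    {F : Set (Fin n → ℝ) | IsEdgeOfPolytope (symEdgePolytope G) F ∧ eVec i j ∈ F} =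
      (fun g => convexHull ℝ {eVec i j, g}) '' goodVecs G i j := by
  have hv : eVec i j ∈ arcVecs G := ⟨i, j, hij, rfl⟩
  ext F
  constructor
  · rintro ⟨⟨hface, hdim⟩, hvF⟩
    obtain ⟨a, M, hle, -, hF⟩ := hface.exists_eq_convexHull ⟨_, hv⟩
    have hmem : ∀ {p q}, G.Adj p q → a p - a q = M → eVec p q ∈ F := by
      intro p q h1 h2
      rw [hF]
      exact subset_convexHull ℝ _ ⟨⟨p, q, h1, rfl⟩, by rw [sum_mul_eVec, h2]⟩
    have hvM : a i - a j = M := by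
      rw [← sum_mul_eVec]
      exact dotProduct_eq_of_mem_convexHull (fun g hg => hg.2) (hF ▸ hvF)
    have hpos : ¬ M ≤ 0 := by
      intro hM
      have h0 : ∀ p q, G.Adj p q → a p - a q = M := by
        intro p q hpq
        have h1 := hle _ _ hpq
        have h2 := hle _ _ hpq.symm
        have h3 := hle _ _ hij.symm
        linarith
      obtain ⟨w, ⟨p, q, hpq, rfl⟩, hw1, hw2⟩ := hw
      have hnv : eVec i j ≠ -eVec i j := eVec_ne_neg hij.ne fun h => hij.ne h.1
      have hv' : -eVec i j ∈ F := by
        rw [neg_eVec]; exact hmem hij.symm (h0 _ _ hij.symm)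
      rcases eq_or_eq_of_polyDim_eq_one hdim hv (neg_mem_arcVecs hv) ⟨p, q, hpq, rfl⟩ hvF hv'
        (hmem hpq (h0 _ _ hpq)) hnv with h | h
      · exact hw1 h
      · exact hw2 h
    obtain ⟨k, l, hkl, hklM, hne⟩ : ∃ k l, G.Adj k l ∧ a k - a l = M ∧ ¬ (k = i ∧ l = j) := by
      by_contra! hcon
      have : {g | g ∈ arcVecs G ∧ ∑ t, a t * g t = M} = {eVec i j} := by
        ext g
        constructor
        · rintro ⟨⟨p, q, hpq, rfl⟩, hM⟩
          rw [sum_mul_eVec] at hM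
          obtain ⟨rfl, rfl⟩ := hcon p q hpq hM
          rfl
        · rintro rfl
          exact ⟨hv, by rw [sum_mul_eVec, hvM]⟩
      rw [this, convexHull_singleton] at hF
      rw [hF, polyDim_singleton] at hdim
      exact zero_ne_one hdim
    have hne' : eVec i j ≠ eVec k l := fun h =>
      hne ⟨(eVec_inj hij.ne h).1.symm, (eVec_inj hij.ne h).2.symm⟩
    have honly : ∀ p q, G.Adj p q → a p - a q = M → (p = i ∧ q = j) ∨ (p = k ∧ q = l) := by
      intro p q hpq hM
      rcases eq_or_eq_of_polyDim_eq_one hdim hv ⟨k, l, hkl, rfl⟩ ⟨p, q, hpq, rfl⟩ hvF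
        (hmem hkl hklM) (hmem hpq hM) hne' with h | h
      · exact Or.inl (eVec_inj hpq.ne h)
      · exact Or.inr (eVec_inj hpq.ne h)
    have hrev : ¬ (k = j ∧ l = i) := by
      rintro ⟨rfl, rfl⟩
      exact hpos (by linarith)
    refine ⟨eVec k l, ⟨k, l, ⟨hkl, hne, hrev, fun hb => ?_⟩, rfl⟩, ?_⟩
    · rcases hb.exists_third hij hkl hne hrev hle hvM hklM with h | ⟨p, q, hpq, hM, h1, h2⟩
      · exact hpos h
      · exact (honly p q hpq hM).elim h1 h2
    · dsimp only
      rw [hF]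
      congr 1
      ext g
      constructor
      · rintro (rfl | rfl)
        · exact ⟨hv, by rw [sum_mul_eVec, hvM]⟩
        · exact ⟨⟨k, l, hkl, rfl⟩, by rw [sum_mul_eVec, hklM]⟩
      · rintro ⟨⟨p, q, hpq, rfl⟩, hM⟩
        rw [sum_mul_eVec] at hM
        rcases honly p q hpq hM with ⟨rfl, rfl⟩ | ⟨rfl, rfl⟩
        · exact Or.inl rfl
        · exact Or.inr rfl
  · rintro ⟨_, ⟨k, l, ⟨hkl, hne, hrev, hb⟩, rfl⟩, rfl⟩
    obtain ⟨a, M, h⟩ := exists_exposes_of_not_badArc hij hkl hrev hb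
    refine ⟨⟨h.isFaceOfPolytope hij hkl, polyDim_pair fun h => ?_⟩,
      subset_convexHull ℝ _ (Or.inl rfl)⟩
    exact hne ⟨(eVec_inj hij.ne h).1.symm, (eVec_inj hij.ne h).2.symm⟩

theorem ncard_isEdgeOfPolytope {n : ℕ} {G : SimpleGraph (Fin n)} {i j : Fin n}
    (hij : G.Adj i j) (hw : ∃ w ∈ arcVecs G, w ≠ eVec i j ∧ w ≠ -eVec i j) :
    Set.ncard {F : Set (Fin n → ℝ) | IsEdgeOfPolytope (symEdgePolytope G) F ∧ eVec i j ∈ F} =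
      (goodVecs G i j).ncard := by
  rw [setOf_isEdgeOfPolytope_eq hij hw]
  refine Set.InjOn.ncard_image ?_
  have hne : ∀ k l, GoodArc G i j k l → eVec i j ≠ eVec k l := fun k l h h' =>
    h.2.1 ⟨(eVec_inj hij.ne h').1.symm, (eVec_inj hij.ne h').2.symm⟩
  rintro _ ⟨k, l, h, rfl⟩ _ ⟨p, q, h', rfl⟩ heq
  dsimp only at heq
  have hmem : eVec p q ∈ convexHull ℝ {eVec i j, eVec k l} := by
    rw [heq]; exact subset_convexHull ℝ _ (Or.inr rfl)
  rcases eq_or_eq_of_polyDim_eq_one (polyDim_pair (hne k l h)) (G := G) ⟨i, j, hij, rfl⟩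
    ⟨k, l, h.1, rfl⟩ ⟨p, q, h'.1, rfl⟩ (subset_convexHull ℝ _ (Or.inl rfl))
    (subset_convexHull ℝ _ (Or.inr rfl)) hmem (hne k l h) with h1 | h1
  · exact absurd h1.symm (hne p q h')
  · exact h1.symm

/-- A symmetric edge polytope of a graph with a single edge is simple. -/
theorem isSimplePolytope_of_forall_adj {n : ℕ} {G : SimpleGraph (Fin n)} {i j : Fin n}
    (hij : G.Adj i j) (h : ∀ w ∈ arcVecs G, w = eVec i j ∨ w = -eVec i j) :
    IsSimplePolytope (symEdgePolytope G) := by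
  have hv : eVec i j ∈ arcVecs G := ⟨i, j, hij, rfl⟩
  have hA : arcVecs G = {eVec i j, -eVec i j} := by
    ext w
    refine ⟨h w, ?_⟩
    rintro (rfl | rfl)
    · exact hv
    · exact neg_mem_arcVecs hv
  have hnv : eVec i j ≠ -eVec i j := eVec_ne_neg hij.ne fun h => hij.ne h.1
  have hdim : polyDim (symEdgePolytope G) = 1 := by
    have : symEdgePolytope G = convexHull ℝ (arcVecs G) := rfl
    rw [this, hA, polyDim_pair hnv]
  intro v hvert
  have hvA := hvert.mem_arcVecs ⟨_, hv⟩
  rw [hdim, Set.ncard_eq_one]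
  refine ⟨symEdgePolytope G, ?_⟩
  ext F
  constructor
  · rintro ⟨⟨hface, hFdim⟩, hvF⟩
    obtain ⟨a, M, hle, ⟨g, hg, hgM⟩, hF⟩ := hface.exists_eq_convexHull ⟨_, hv⟩
    by_cases hall : ∀ x ∈ arcVecs G, ∑ t, a t * x t = M
    · rw [hF]
      change convexHull ℝ _ = convexHull ℝ (arcVecs G)
      congr 1
      ext x
      exact ⟨fun hx => hx.1, fun hx => ⟨hx, hall x hx⟩⟩
    · exfalso
      have : {x | x ∈ arcVecs G ∧ ∑ t, a t * x t = M} ⊆ {g} := by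
        rintro x ⟨hx, hxM⟩
        by_contra hxg
        apply hall
        intro y hy
        rw [hA] at hx hy hg
        have hxg : x ≠ g := hxg
        rcases hx with rfl | rfl <;> rcases hy with rfl | rfl <;> rcases hg with rfl | rfl <;>
          first | assumption | exact absurd rfl hxg
      have : {x | x ∈ arcVecs G ∧ ∑ t, a t * x t = M} = {g} :=
        this.antisymm (by rintro _ rfl; exact ⟨hg, hgM⟩)
      rw [this, convexHull_singleton] at hF
      rw [hF, polyDim_singleton] at hFdim
      exact zero_ne_one hFdim
  · rintro rfl
    refine ⟨⟨⟨0, ?_⟩, hdim⟩, subset_convexHull ℝ _ hvA⟩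
    simp

theorem BadArc.exists_path {n : ℕ} {G : SimpleGraph (Fin n)} {i j k l : Fin n}
    (h : BadArc G i j k l) (hkl : G.Adj k l) (hne : ¬ (k = i ∧ l = j))
    (hrev : ¬ (k = j ∧ l = i)) :
    (∃ c, G.Adj i c ∧ G.Adj c j ∧ (s(k, l) = s(i, c) ∨ s(k, l) = s(c, j))) ∨
    ∃ y x, G.Adj i y ∧ G.Adj y x ∧ G.Adj x j ∧ y ≠ j ∧ x ≠ i ∧
      (s(k, l) = s(i, y) ∨ s(k, l) = s(y, x) ∨ s(k, l) = s(x, j)) := by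
  rcases h with ⟨rfl, h | ⟨y, hy, h3, h4⟩⟩ | ⟨rfl, h | ⟨y, hy, h3, h4⟩⟩ | ⟨hik, hjl, h3, h4⟩
  · exact Or.inl ⟨l, h, hkl.symm, Or.inr Sym2.eq_swap⟩
  · exact Or.inr ⟨y, l, h3, h4, hkl.symm, hy, fun h => hrev ⟨rfl, h⟩,
      Or.inr (Or.inr Sym2.eq_swap)⟩
  · exact Or.inl ⟨k, hkl.symm, h, Or.inl Sym2.eq_swap⟩
  · exact Or.inr ⟨k, y, hkl.symm, h3, h4, fun h => hrev ⟨h, rfl⟩, hy, Or.inl Sym2.eq_swap⟩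
  · exact Or.inr ⟨l, k, h3, hkl.symm, h4, hjl.symm, hik.symm, Or.inr (Or.inl Sym2.eq_swap)⟩

theorem goodArc_or_goodArc {n : ℕ} {G : SimpleGraph (Fin n)} {i j k l : Fin n}
    (hij : G.Adj i j) (hkl : G.Adj k l) (hne : s(k, l) ≠ s(i, j))
    (hC : ¬ (G.Adj i k ∧ G.Adj k j ∧ G.Adj i l ∧ G.Adj l j)) :
    GoodArc G i j k l ∨ GoodArc G i j l k := by
  have h1 := hij.ne
  have h2 := hkl.ne
  simp only [ne_eq, Sym2.eq_iff, not_or] at hne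
  by_cases hb : BadArc G i j k l
  · refine Or.inr ⟨hkl.symm, by tauto, by tauto, fun hb' => ?_⟩
    rcases hb with ⟨rfl, -⟩ | ⟨rfl, -⟩ | ⟨hik, hjl, h3, h4⟩
    · rcases hb' with ⟨h, -⟩ | ⟨h, -⟩ | ⟨-, h, -⟩
      · exact h2 h
      · exact h1 h.symm
      · exact h rfl
    · rcases hb' with ⟨h, -⟩ | ⟨h, -⟩ | ⟨h, -⟩
      · exact h1 h.symm
      · exact h2 h
      · exact h rfl
    · rcases hb' with ⟨rfl, -⟩ | ⟨rfl, -⟩ | ⟨-, -, h5, h6⟩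
      · exact hjl rfl
      · exact hik rfl
      · exact hC ⟨h5, h4, h3, h6⟩
  · exact Or.inl ⟨hkl, hne.1, hne.2, hb⟩

theorem eVec_mem_span_goodVecs {n : ℕ} {G : SimpleGraph (Fin n)} {i j k l : Fin n}
    (hij : G.Adj i j) (hkl : G.Adj k l) (hne : s(k, l) ≠ s(i, j))
    (hC : ¬ (G.Adj i k ∧ G.Adj k j ∧ G.Adj i l ∧ G.Adj l j)) :
    eVec k l ∈ Submodule.span ℝ (goodVecs G i j) := by
  rcases goodArc_or_goodArc hij hkl hne hC with h | h
  · exact Submodule.subset_span ⟨k, l, h, rfl⟩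
  · rw [← neg_eVec]
    exact neg_mem (Submodule.subset_span ⟨l, k, h, rfl⟩)

theorem eVec_mem_span_of_common {n : ℕ} {G : SimpleGraph (Fin n)} {i j c : Fin n}
    (hij : G.Adj i j) (hic : G.Adj i c) (hcj : G.Adj c j) :
    eVec i c ∈ Submodule.span ℝ (goodVecs G i j) ∧
      eVec c j ∈ Submodule.span ℝ (goodVecs G i j) := by
  have h1 := hij.ne
  have h2 := hic.ne
  have h3 := hcj.ne
  exact ⟨eVec_mem_span_goodVecs hij hic (by grind) fun h => G.irrefl h.1,
    eVec_mem_span_goodVecs hij hcj (by grind) fun h => G.irrefl h.2.2.2⟩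

theorem goodVecs_subset {n : ℕ} {G : SimpleGraph (Fin n)} {i j : Fin n} :
    goodVecs G i j ⊆ arcVecs G := by
  rintro _ ⟨k, l, h, rfl⟩
  exact ⟨k, l, h.1, rfl⟩

theorem span_goodVecs_eq {n : ℕ} {G : SimpleGraph (Fin n)} {i j : Fin n} (hij : G.Adj i j)
    (hv : eVec i j ∈ Submodule.span ℝ (goodVecs G i j)) :
    Submodule.span ℝ (goodVecs G i j) = Submodule.span ℝ (arcVecs G) := by
  refine le_antisymm (Submodule.span_mono goodVecs_subset) (Submodule.span_le.2 ?_)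
  rintro _ ⟨k, l, hkl, rfl⟩
  by_cases hne : s(k, l) = s(i, j)
  · rcases Sym2.eq_iff.1 hne with ⟨rfl, rfl⟩ | ⟨rfl, rfl⟩
    · exact hv
    · rw [← neg_eVec]; exact neg_mem hv
  by_cases hC : G.Adj i k ∧ G.Adj k j ∧ G.Adj i l ∧ G.Adj l j
  · obtain ⟨h1, h2, h3, h4⟩ := hC
    rw [← eVec_add_eVec k j l, ← neg_eVec l j]
    exact add_mem (eVec_mem_span_of_common hij h1 h2).2
      (neg_mem (eVec_mem_span_of_common hij h3 h4).2)
  · exact eVec_mem_span_goodVecs hij hkl hne hC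

/-- The vectors outside `v` in a linearly independent set of differences are annihilated by a
potential that does not annihilate `v`. -/
theorem exists_potential {n : ℕ} {S : Set (Fin n → ℝ)}
    (hS : LinearIndependent ℝ ((↑) : S → Fin n → ℝ)) {k l : Fin n} (h : eVec k l ∈ S) :
    ∃ a : Fin n → ℝ, a k ≠ a l ∧ ∀ p q, eVec p q ∈ S → eVec p q ≠ eVec k l → a p = a q := by
  have hnot : eVec k l ∉ Submodule.span ℝ (S \ {eVec k l}) := by
    have := hS.notMem_span_image (s := {x | (x : Fin n → ℝ) ≠ eVec k l}) (x := ⟨_, h⟩)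
      (fun h => h rfl)
    convert this using 3
    ext x
    simp only [Set.mem_sdiff, Set.mem_singleton_iff, Set.mem_image, Subtype.exists]
    constructor
    · rintro ⟨h1, h2⟩
      exact ⟨x, h1, h2, rfl⟩
    · rintro ⟨y, h1, h2, rfl⟩
      exact ⟨h1, h2⟩
  obtain ⟨φ, hφ, hker⟩ := Submodule.exists_le_ker_of_notMem hnot
  have key : ∀ p q, φ (eVec p q) = φ (Pi.single p 1) - φ (Pi.single q 1) := by
    intro p q
    rw [← map_sub]
    congr 1
    funext t
    simp [eVec, Pi.single_apply]
  refine ⟨fun t => φ (Pi.single t 1), ?_, ?_⟩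
  · rw [key] at hφ
    exact sub_ne_zero.1 hφ
  · intro p q h1 h2
    have : eVec p q ∈ LinearMap.ker φ := hker (Submodule.subset_span ⟨h1, h2⟩)
    rw [LinearMap.mem_ker, key] at this
    exact sub_eq_zero.1 this

theorem linearIndependent_of_ncard_eq {n : ℕ} {S : Set (Fin n → ℝ)} (hfin : S.Finite)
    (h : S.ncard = Module.finrank ℝ (Submodule.span ℝ S)) :
    LinearIndependent ℝ ((↑) : S → Fin n → ℝ) := by
  have := hfin.fintype
  rw [linearIndependent_iff_card_eq_finrank_span, Subtype.range_coe, Set.finrank, ← h,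
    Set.ncard_eq_toFinset_card', Set.toFinset_card]

section CommonNeighbors

variable {n : ℕ} {G : SimpleGraph (Fin n)} {i j : Fin n}

theorem exists_potential_of_linearIndependent (hij : G.Adj i j)
    (hS : LinearIndependent ℝ ((↑) : goodVecs G i j → Fin n → ℝ)) {k l : Fin n}
    (hkl : G.Adj k l) (hne : s(k, l) ≠ s(i, j))
    (hC : ¬ (G.Adj i k ∧ G.Adj k j ∧ G.Adj i l ∧ G.Adj l j)) :
    ∃ a : Fin n → ℝ, a k ≠ a l ∧ ∀ p q, G.Adj p q → s(p, q) ≠ s(i, j) →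
      ¬ (G.Adj i p ∧ G.Adj p j ∧ G.Adj i q ∧ G.Adj q j) → s(p, q) ≠ s(k, l) → a p = a q := by
  have main : ∀ k l, GoodArc G i j k l → ∃ a : Fin n → ℝ, a k ≠ a l ∧
      ∀ p q, G.Adj p q → s(p, q) ≠ s(i, j) →
      ¬ (G.Adj i p ∧ G.Adj p j ∧ G.Adj i q ∧ G.Adj q j) → s(p, q) ≠ s(k, l) → a p = a q := by
    intro k l h
    obtain ⟨a, ha, hpot⟩ := exists_potential hS (k := k) (l := l) ⟨k, l, h, rfl⟩
    refine ⟨a, ha, fun p q hpq h1 h2 h3 => ?_⟩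
    rcases goodArc_or_goodArc hij hpq h1 h2 with h4 | h4
    · refine hpot p q ⟨p, q, h4, rfl⟩ fun h => h3 ?_
      obtain ⟨rfl, rfl⟩ := eVec_inj hpq.ne h
      rfl
    · refine (hpot q p ⟨q, p, h4, rfl⟩ fun h => h3 ?_).symm
      obtain ⟨rfl, rfl⟩ := eVec_inj hpq.ne' h
      exact Sym2.eq_swap
  rcases goodArc_or_goodArc hij hkl hne hC with h | h
  · exact main k l h
  · obtain ⟨a, ha, hpot⟩ := main l k h
    exact ⟨a, ha.symm, fun p q h1 h2 h3 h4 => hpot p q h1 h2 h3 (by rwa [Sym2.eq_swap (a := l)])⟩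

theorem badArc_or_badArc_of_linearIndependent
    (hS : LinearIndependent ℝ ((↑) : goodVecs G i j → Fin n → ℝ)) {k l : Fin n}
    (hkl : G.Adj k l) (hne : s(k, l) ≠ s(i, j)) : BadArc G i j k l ∨ BadArc G i j l k := by
  simp only [ne_eq, Sym2.eq_iff, not_or] at hne
  by_contra! hcon
  have h1 : eVec k l ∈ goodVecs G i j := ⟨k, l, ⟨hkl, hne.1, hne.2, hcon.1⟩, rfl⟩
  have h2 : eVec l k ∈ goodVecs G i j :=
    ⟨l, k, ⟨hkl.symm, by tauto, by tauto, hcon.2⟩, rfl⟩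
  obtain ⟨a, ha, hpot⟩ := exists_potential hS h1
  exact ha (hpot l k h2 fun h => hkl.ne (eVec_inj hkl.ne' h).2).symm

theorem exists_path_of_linearIndependent
    (hS : LinearIndependent ℝ ((↑) : goodVecs G i j → Fin n → ℝ)) {k l : Fin n}
    (hkl : G.Adj k l) (hne : s(k, l) ≠ s(i, j)) :
    (∃ c, G.Adj i c ∧ G.Adj c j ∧ (s(k, l) = s(i, c) ∨ s(k, l) = s(c, j))) ∨
    ∃ y x, G.Adj i y ∧ G.Adj y x ∧ G.Adj x j ∧ y ≠ j ∧ x ≠ i ∧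
      (s(k, l) = s(i, y) ∨ s(k, l) = s(y, x) ∨ s(k, l) = s(x, j)) := by
  have hne' := hne
  simp only [ne_eq, Sym2.eq_iff, not_or] at hne'
  rcases badArc_or_badArc_of_linearIndependent hS hkl hne with h | h
  · exact h.exists_path hkl hne'.1 hne'.2
  · rw [Sym2.eq_swap (a := k)]
    exact h.exists_path hkl.symm (by tauto) (by tauto)

theorem adj_iff_triangle_of_linearIndependent (hij : G.Adj i j)
    (hS : LinearIndependent ℝ ((↑) : goodVecs G i j → Fin n → ℝ)) {c : Fin n}
    (hic : G.Adj i c) (hcj : G.Adj c j) (k l : Fin n) :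
    G.Adj k l ↔ s(k, l) = s(i, j) ∨ s(k, l) = s(i, c) ∨ s(k, l) = s(c, j) := by
  have nij := hij.ne
  have nic := hic.ne
  have ncj := hcj.ne
  obtain ⟨a, ha, ha'⟩ := exists_potential_of_linearIndependent hij hS hic
      (by rw [ne_eq, Sym2.eq_iff]; grind only)
    (fun h => G.irrefl h.1)
  obtain ⟨b, hb, hb'⟩ := exists_potential_of_linearIndependent hij hS hcj
      (by rw [ne_eq, Sym2.eq_iff]; grind only)
    (fun h => G.irrefl h.2.2.2)
  have hacj : a c = a j := ha' c j hcj
      (by rw [ne_eq, Sym2.eq_iff]; grind only) (fun h => G.irrefl h.2.2.2)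
      (by rw [ne_eq, Sym2.eq_iff]; grind only)
  have huniq : ∀ d, G.Adj i d → G.Adj d j → d = c := by
    intro d h1 h2
    by_contra hdc
    have n1 := h1.ne
    have n2 := h2.ne
    have e1 : a i = a d := ha' i d h1
        (by rw [ne_eq, Sym2.eq_iff]; grind only) (fun h => G.irrefl h.1)
        (by rw [ne_eq, Sym2.eq_iff]; grind only)
    have e2 : a d = a j := ha' d j h2
        (by rw [ne_eq, Sym2.eq_iff]; grind only) (fun h => G.irrefl h.2.2.2)
        (by rw [ne_eq, Sym2.eq_iff]; grind only)
    exact ha (e1.trans (e2.trans hacj.symm))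
  have hnoC : ∀ p q, G.Adj p q → ¬ (G.Adj i p ∧ G.Adj p j ∧ G.Adj i q ∧ G.Adj q j) := by
    rintro p q hpq ⟨h1, h2, h3, h4⟩
    exact hpq.ne ((huniq p h1 h2).trans (huniq q h3 h4).symm)
  have hnopath : ∀ y x, G.Adj i y → G.Adj y x → G.Adj x j → y ≠ j → x ≠ i → False := by
    intro y x h1 h2 h3 hyj hxi
    have n1 := h1.ne
    have n2 := h2.ne
    have n3 := h3.ne
    by_cases hyc : y = c
    · subst hyc
      have e1 : b y = b x := hb' y x h2
          (by rw [ne_eq, Sym2.eq_iff]; grind only) (hnoC _ _ h2)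
          (by rw [ne_eq, Sym2.eq_iff]; grind only)
      have e2 : b x = b j := hb' x j h3
          (by rw [ne_eq, Sym2.eq_iff]; grind only) (hnoC _ _ h3)
          (by rw [ne_eq, Sym2.eq_iff]; grind only)
      exact hb (e1.trans e2)
    · have e1 : a i = a y := ha' i y h1
          (by rw [ne_eq, Sym2.eq_iff]; grind only) (hnoC _ _ h1)
          (by rw [ne_eq, Sym2.eq_iff]; grind only)
      have e2 : a y = a x := ha' y x h2
          (by rw [ne_eq, Sym2.eq_iff]; grind only) (hnoC _ _ h2)
          (by rw [ne_eq, Sym2.eq_iff]; grind only)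
      have e3 : a x = a j := ha' x j h3
          (by rw [ne_eq, Sym2.eq_iff]; grind only) (hnoC _ _ h3)
          (by rw [ne_eq, Sym2.eq_iff]; grind only)
      exact ha (e1.trans (e2.trans (e3.trans hacj.symm)))
  constructor
  · intro hkl
    by_cases hne : s(k, l) = s(i, j)
    · exact Or.inl hne
    right
    rcases exists_path_of_linearIndependent hS hkl hne with
      ⟨d, h1, h2, h3⟩ | ⟨y, x, h1, h2, h3, h4, h5, -⟩
    · rwa [← huniq d h1 h2]
    · exact (hnopath y x h1 h2 h3 h4 h5).elim
  · simp only [← SimpleGraph.mem_edgeSet]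
    rintro (h | h | h) <;> rw [h] <;> assumption

theorem adj_iff_square_of_linearIndependent (hij : G.Adj i j)
    (hS : LinearIndependent ℝ ((↑) : goodVecs G i j → Fin n → ℝ))
    (hC : ∀ c, G.Adj i c → ¬ G.Adj c j) {y x : Fin n}
    (hiy : G.Adj i y) (hyx : G.Adj y x) (hxj : G.Adj x j) (hyj : y ≠ j) (hxi : x ≠ i)
    (k l : Fin n) :
    G.Adj k l ↔ s(k, l) = s(i, j) ∨ s(k, l) = s(i, y) ∨ s(k, l) = s(y, x) ∨ s(k, l) = s(x, j) := by
  have nij := hij.ne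
  have niy := hiy.ne
  have nyx := hyx.ne
  have nxj := hxj.ne
  have hC' : ∀ p q, ¬ (G.Adj i p ∧ G.Adj p j ∧ G.Adj i q ∧ G.Adj q j) :=
    fun p q h => hC p h.1 h.2.1
  obtain ⟨a, ha, ha'⟩ := exists_potential_of_linearIndependent hij hS hiy
      (by rw [ne_eq, Sym2.eq_iff]; grind only) (hC' _ _)
  obtain ⟨b, hb, hb'⟩ := exists_potential_of_linearIndependent hij hS hxj
      (by rw [ne_eq, Sym2.eq_iff]; grind only) (hC' _ _)
  have ea1 : a y = a x := ha' y x hyx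
      (by rw [ne_eq, Sym2.eq_iff]; grind only) (hC' _ _)
      (by rw [ne_eq, Sym2.eq_iff]; grind only)
  have ea2 : a x = a j := ha' x j hxj
      (by rw [ne_eq, Sym2.eq_iff]; grind only) (hC' _ _)
      (by rw [ne_eq, Sym2.eq_iff]; grind only)
  have eb1 : b y = b x := hb' y x hyx
      (by rw [ne_eq, Sym2.eq_iff]; grind only) (hC' _ _)
      (by rw [ne_eq, Sym2.eq_iff]; grind only)
  have eb2 : b i = b y := hb' i y hiy
      (by rw [ne_eq, Sym2.eq_iff]; grind only) (hC' _ _)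
      (by rw [ne_eq, Sym2.eq_iff]; grind only)
  have huniq : ∀ y' x', G.Adj i y' → G.Adj y' x' → G.Adj x' j → y' ≠ j → x' ≠ i →
      y' = y ∧ x' = x := by
    intro y' x' h1 h2 h3 hyj' hxi'
    have n1 := h1.ne
    have n2 := h2.ne
    have n3 := h3.ne
    constructor
    · by_contra hyy
      have e1 : a i = a y' := ha' i y' h1
          (by rw [ne_eq, Sym2.eq_iff]; grind only) (hC' _ _)
          (by rw [ne_eq, Sym2.eq_iff]; grind only)
      have e2 : a y' = a x' := ha' y' x' h2
          (by rw [ne_eq, Sym2.eq_iff]; grind only) (hC' _ _)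
          (by rw [ne_eq, Sym2.eq_iff]; grind only)
      have e3 : a x' = a j := ha' x' j h3
          (by rw [ne_eq, Sym2.eq_iff]; grind only) (hC' _ _)
          (by rw [ne_eq, Sym2.eq_iff]; grind only)
      exact ha (by rw [e1, e2, e3, ea1, ea2])
    · by_contra hxx
      have e1 : b i = b y' := hb' i y' h1
          (by rw [ne_eq, Sym2.eq_iff]; grind only) (hC' _ _)
          (by rw [ne_eq, Sym2.eq_iff]; grind only)
      have e2 : b y' = b x' := hb' y' x' h2
          (by rw [ne_eq, Sym2.eq_iff]; grind only) (hC' _ _)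
          (by rw [ne_eq, Sym2.eq_iff]; grind only)
      have e3 : b x' = b j := hb' x' j h3
          (by rw [ne_eq, Sym2.eq_iff]; grind only) (hC' _ _)
          (by rw [ne_eq, Sym2.eq_iff]; grind only)
      exact hb (by rw [← eb1, ← eb2, e1, e2, e3])
  constructor
  · intro hkl
    by_cases hne : s(k, l) = s(i, j)
    · exact Or.inl hne
    right
    rcases exists_path_of_linearIndependent hS hkl hne with
      ⟨d, h1, h2, -⟩ | ⟨y', x', h1, h2, h3, h4, h5, h6⟩
    · exact (hC d h1 h2).elim
    · obtain ⟨rfl, rfl⟩ := huniq y' x' h1 h2 h3 h4 h5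
      exact h6
  · simp only [← SimpleGraph.mem_edgeSet]
    rintro (h | h | h | h) <;> rw [h] <;> assumption

/-- If `e_i - e_j` is not spanned by its neighbors, then it is adjacent to all vertices of the
polytope other than its antipode. -/
theorem goodArc_of_notMem_span (hij : G.Adj i j)
    (hv : eVec i j ∉ Submodule.span ℝ (goodVecs G i j)) {k l : Fin n} (hkl : G.Adj k l)
    (hne : s(k, l) ≠ s(i, j)) : GoodArc G i j k l := by
  have nij := hij.ne
  simp only [ne_eq, Sym2.eq_iff, not_or] at hne
  refine ⟨hkl, hne.1, hne.2, fun hb => hv ?_⟩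
  have hCmem : ∀ c, G.Adj i c → G.Adj c j → eVec i j ∈ Submodule.span ℝ (goodVecs G i j) := by
    intro c h1 h2
    rw [← eVec_add_eVec i c j]
    exact add_mem (eVec_mem_span_of_common hij h1 h2).1 (eVec_mem_span_of_common hij h1 h2).2
  rcases hb.exists_path hkl hne.1 hne.2 with ⟨c, h1, h2, -⟩ | ⟨y, x, h1, h2, h3, h4, h5, -⟩
  · exact hCmem c h1 h2
  · by_cases hC : ∃ c, G.Adj i c ∧ G.Adj c j
    · obtain ⟨c, h1, h2⟩ := hC
      exact hCmem c h1 h2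
    · have n1 := h1.ne
      have n2 := h2.ne
      have n3 := h3.ne
      have hC' : ∀ p q, ¬ (G.Adj i p ∧ G.Adj p j ∧ G.Adj i q ∧ G.Adj q j) :=
        fun p q h => hC ⟨p, h.1, h.2.1⟩
      rw [← eVec_add_eVec i y j, ← eVec_add_eVec y x j]
      exact add_mem (eVec_mem_span_goodVecs hij h1
          (by rw [ne_eq, Sym2.eq_iff]; grind only) (hC' _ _))
        (add_mem (eVec_mem_span_goodVecs hij h2 (by rw [ne_eq, Sym2.eq_iff]; grind only) (hC' _ _))
          (eVec_mem_span_goodVecs hij h3 (by rw [ne_eq, Sym2.eq_iff]; grind only) (hC' _ _)))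

theorem eq_of_notMem_span (hij : G.Adj i j)
    (hcard : (goodVecs G i j).ncard = Module.finrank ℝ (Submodule.span ℝ (arcVecs G)))
    (hv : eVec i j ∉ Submodule.span ℝ (goodVecs G i j)) {k l p q : Fin n} (hkl : G.Adj k l)
    (hne : s(k, l) ≠ s(i, j)) (hpq : G.Adj p q) (hne' : s(p, q) ≠ s(i, j)) :
    s(p, q) = s(k, l) := by
  by_contra hpk
  have hlk : s(l, k) ≠ s(i, j) := by rwa [Sym2.eq_swap]
  have hqp : s(q, p) ≠ s(i, j) := by rwa [Sym2.eq_swap]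
  have hgood : ∀ {u w}, G.Adj u w → s(u, w) ≠ s(i, j) → eVec u w ∈ goodVecs G i j :=
    fun h1 h2 => ⟨_, _, goodArc_of_notMem_span hij hv h1 h2, rfl⟩
  have hfin : (goodVecs G i j).Finite := (arcVecs_finite G).subset goodVecs_subset
  have h1 : eVec l k ∉ ({eVec q p} : Set (Fin n → ℝ)) := by
    intro h
    obtain ⟨rfl, rfl⟩ := eVec_inj hkl.ne' h
    exact hpk rfl
  have hsub : ({eVec l k, eVec q p} : Set (Fin n → ℝ)) ⊆ goodVecs G i j := by
    rintro _ (rfl | rfl)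
    · exact hgood hkl.symm hlk
    · exact hgood hpq.symm hqp
  set T : Set (Fin n → ℝ) := insert (eVec i j) (goodVecs G i j \ {eVec l k, eVec q p}) with hT
  have hTfin : T.Finite := (hfin.subset Set.sdiff_subset).insert _
  have hTcard : T.ncard + 1 ≤ (goodVecs G i j).ncard := by
    have e1 := Set.ncard_insert_le (eVec i j) (goodVecs G i j \ {eVec l k, eVec q p})
    have e2 := Set.ncard_sdiff_add_ncard_of_subset hsub hfin
    have e3 : ({eVec l k, eVec q p} : Set (Fin n → ℝ)).ncard = 2 :=
      Set.ncard_pair fun h => h1 h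
    rw [← hT] at e1
    omega
  have hspan : Submodule.span ℝ (arcVecs G) ≤ Submodule.span ℝ T := by
    refine Submodule.span_le.2 ?_
    have hvT : eVec i j ∈ Submodule.span ℝ T := Submodule.subset_span (Or.inl rfl)
    have hmem : ∀ {u w}, G.Adj u w → s(u, w) ≠ s(i, j) → ¬ (u = l ∧ w = k) →
        ¬ (u = q ∧ w = p) → eVec u w ∈ Submodule.span ℝ T := by
      intro u w h2 h3 h4 h5
      refine Submodule.subset_span (Or.inr ⟨hgood h2 h3, ?_⟩)
      rintro (h | h)
      · exact h4 (eVec_inj h2.ne h)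
      · exact h5 (eVec_inj h2.ne h)
    have nkl := hkl.ne
    have npq := hpq.ne
    rintro _ ⟨u, w, huw, rfl⟩
    by_cases h2 : s(u, w) = s(i, j)
    · rcases Sym2.eq_iff.1 h2 with ⟨rfl, rfl⟩ | ⟨rfl, rfl⟩
      · exact hvT
      · rw [← neg_eVec]; exact neg_mem hvT
    by_cases h3 : (u = l ∧ w = k) ∨ (u = q ∧ w = p)
    · rw [← neg_eVec]
      exact neg_mem (hmem huw.symm (by rwa [Sym2.eq_swap]) (by grind) (by grind))
    · rw [not_or] at h3
      exact hmem huw h2 h3.1 h3.2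
  have h4 : Module.finrank ℝ (Submodule.span ℝ (arcVecs G)) ≤
      Module.finrank ℝ (Submodule.span ℝ T) := Submodule.finrank_mono hspan
  have h5 : Module.finrank ℝ (Submodule.span ℝ T) ≤ T.ncard := by
    have := hTfin.fintype
    rw [Set.ncard_eq_toFinset_card']
    exact finrank_span_le_card T
  omega

/-- A graph all of whose vertex figures at `i → j` have the expected size is a pair of edges, a
triangle or a square. -/
theorem adj_iff_of_ncard_goodVecs (hij : G.Adj i j)
    (hcard : (goodVecs G i j).ncard = Module.finrank ℝ (Submodule.span ℝ (arcVecs G)))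
    {k l : Fin n} (hkl : G.Adj k l) (hne : s(k, l) ≠ s(i, j)) :
    (∀ p q, G.Adj p q ↔ s(p, q) = s(i, j) ∨ s(p, q) = s(k, l)) ∨
    (∃ c, G.Adj i c ∧ G.Adj c j ∧
      ∀ p q, G.Adj p q ↔ s(p, q) = s(i, j) ∨ s(p, q) = s(i, c) ∨ s(p, q) = s(c, j)) ∨
    (∃ y x, G.Adj i y ∧ G.Adj y x ∧ G.Adj x j ∧ y ≠ j ∧ x ≠ i ∧
      ∀ p q, G.Adj p q ↔
        s(p, q) = s(i, j) ∨ s(p, q) = s(i, y) ∨ s(p, q) = s(y, x) ∨ s(p, q) = s(x, j)) := by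
  by_cases hv : eVec i j ∈ Submodule.span ℝ (goodVecs G i j)
  · right
    rw [← span_goodVecs_eq hij hv] at hcard
    have hS := linearIndependent_of_ncard_eq ((arcVecs_finite G).subset goodVecs_subset) hcard
    by_cases hC : ∃ c, G.Adj i c ∧ G.Adj c j
    · obtain ⟨c, h1, h2⟩ := hC
      exact Or.inl ⟨c, h1, h2, adj_iff_triangle_of_linearIndependent hij hS h1 h2⟩
    · have hC' : ∀ c, G.Adj i c → ¬ G.Adj c j := fun c h1 h2 => hC ⟨c, h1, h2⟩
      rcases exists_path_of_linearIndependent hS hkl hne with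
        ⟨d, h1, h2, -⟩ | ⟨y, x, h1, h2, h3, h4, h5, -⟩
      · exact (hC' d h1 h2).elim
      · exact Or.inr ⟨y, x, h1, h2, h3, h4, h5,
          adj_iff_square_of_linearIndependent hij hS hC' h1 h2 h3 h4 h5⟩
  · left
    intro p q
    constructor
    · intro hpq
      by_cases h : s(p, q) = s(i, j)
      · exact Or.inl h
      · exact Or.inr (eq_of_notMem_span hij hcard hv hkl hne hpq h)
    · simp only [← SimpleGraph.mem_edgeSet]
      rintro (h | h) <;> rw [h] <;> assumption

end CommonNeighbors

theorem linearIndependent_pair_eVec {n : ℕ} {i j k l : Fin n} (hij : i ≠ j) (hkl : k ≠ l)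
    (hne : s(k, l) ≠ s(i, j)) : LinearIndependent ℝ ![eVec i j, eVec k l] := by
  rw [LinearIndependent.pair_iff]
  intro a b h
  simp only [ne_eq, Sym2.eq_iff, not_or] at hne
  have hi := congrFun h i
  have hj := congrFun h j
  have hk := congrFun h k
  have hl := congrFun h l
  simp only [eVec, Pi.add_apply, Pi.smul_apply, smul_eq_mul, Pi.zero_apply] at hi hj hk hl
  grind

theorem linearIndependent_eVec_path {n : ℕ} {i y x j : Fin n} (hiy : i ≠ y) (hix : i ≠ x)
    (hij : i ≠ j) (hyx : y ≠ x) (hyj : y ≠ j) (hxj : x ≠ j) :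
    LinearIndependent ℝ ![eVec i y, eVec y x, eVec x j] := by
  rw [Fintype.linearIndependent_iff]
  intro g hg
  simp only [Fin.sum_univ_three, Matrix.cons_val_zero, Matrix.cons_val_one, Matrix.cons_val] at hg
  have hi := congrFun hg i
  have hy := congrFun hg y
  have hj := congrFun hg j
  simp [eVec, hiy, hix, hij, hyx, hyj, hiy.symm, hij.symm, hyj.symm,
    hxj.symm] at hi hy hj
  rw [hi] at hy
  intro t
  fin_cases t
  · exact hi
  · simpa using hy
  · exact hj

theorem ncard_goodVecs_of_eq_range {n m : ℕ} {G : SimpleGraph (Fin n)} {i j : Fin n}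
    (hij : G.Adj i j) {B : Fin m → Fin n → ℝ} (hB : LinearIndependent ℝ B)
    (hgood : goodVecs G i j = Set.range B)
    (hv : eVec i j ∈ Submodule.span ℝ (goodVecs G i j)) :
    (goodVecs G i j).ncard = Module.finrank ℝ (Submodule.span ℝ (arcVecs G)) := by
  rw [← span_goodVecs_eq hij hv, hgood, finrank_span_eq_card hB, ← Set.image_univ,
    Set.ncard_image_of_injective _ hB.injective, Set.ncard_univ, Nat.card_eq_fintype_card]

theorem ncard_goodVecs_of_two_edges {n : ℕ} {G : SimpleGraph (Fin n)} {i j k l : Fin n}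
    (hij : i ≠ j) (hkl : k ≠ l) (hne : s(k, l) ≠ s(i, j))
    (hG : ∀ p q, G.Adj p q ↔ s(p, q) = s(i, j) ∨ s(p, q) = s(k, l)) :
    (goodVecs G i j).ncard = Module.finrank ℝ (Submodule.span ℝ (arcVecs G)) := by
  have hspan : Submodule.span ℝ (arcVecs G) =
      Submodule.span ℝ (Set.range ![eVec i j, eVec k l]) := by
    apply le_antisymm
    · refine Submodule.span_le.2 ?_
      have h1 : eVec i j ∈ Submodule.span ℝ (Set.range ![eVec i j, eVec k l]) :=
        Submodule.subset_span ⟨0, rfl⟩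
      have h2 : eVec k l ∈ Submodule.span ℝ (Set.range ![eVec i j, eVec k l]) :=
        Submodule.subset_span ⟨1, rfl⟩
      rintro _ ⟨p, q, hpq, rfl⟩
      rcases (hG p q).1 hpq with h | h <;>
        rcases Sym2.eq_iff.1 h with ⟨rfl, rfl⟩ | ⟨rfl, rfl⟩
      · exact h1
      · rw [← neg_eVec q p]; exact neg_mem h1
      · exact h2
      · rw [← neg_eVec q p]; exact neg_mem h2
    · refine Submodule.span_mono ?_
      rintro _ ⟨t, rfl⟩
      fin_cases t
      · exact ⟨i, j, (hG i j).2 (Or.inl rfl), rfl⟩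
      · exact ⟨k, l, (hG k l).2 (Or.inr rfl), rfl⟩
  have hgood : goodVecs G i j = {eVec k l, eVec l k} := by
    have key : ∀ p q, GoodArc G i j p q ↔ (p = k ∧ q = l) ∨ (p = l ∧ q = k) := by
      intro p q
      simp only [ne_eq, Sym2.eq_iff, not_or] at hne hG
      simp only [GoodArc, BadArc, hG]
      grind only
    ext x
    constructor
    · rintro ⟨p, q, h, rfl⟩
      rcases (key p q).1 h with ⟨rfl, rfl⟩ | ⟨rfl, rfl⟩
      · exact Or.inl rfl
      · exact Or.inr rfl
    · rintro (rfl | rfl)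
      · exact ⟨k, l, (key k l).2 (Or.inl ⟨rfl, rfl⟩), rfl⟩
      · exact ⟨l, k, (key l k).2 (Or.inr ⟨rfl, rfl⟩), rfl⟩
  rw [hspan, finrank_span_eq_card (linearIndependent_pair_eVec hij hkl hne), hgood,
    Set.ncard_pair fun h => hkl (eVec_inj hkl h).1, Fintype.card_fin]

theorem ncard_goodVecs_of_triangle {n : ℕ} {G : SimpleGraph (Fin n)} {i j c : Fin n}
    (hij : i ≠ j) (hic : i ≠ c) (hcj : c ≠ j)
    (hG : ∀ p q, G.Adj p q ↔ s(p, q) = s(i, j) ∨ s(p, q) = s(i, c) ∨ s(p, q) = s(c, j)) :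
    (goodVecs G i j).ncard = Module.finrank ℝ (Submodule.span ℝ (arcVecs G)) := by
  have hgood : goodVecs G i j = Set.range ![eVec i c, eVec c j] := by
    have key : ∀ p q, GoodArc G i j p q ↔ (p = i ∧ q = c) ∨ (p = c ∧ q = j) := by
      intro p q
      simp only [Sym2.eq_iff] at hG
      simp only [GoodArc, BadArc, hG]
      grind only
    ext x
    simp only [goodVecs, key, Set.mem_ofPred_eq, Matrix.range_cons, Matrix.range_empty,
      Set.union_empty, Set.mem_union, Set.mem_singleton_iff]
    constructor
    · rintro ⟨p, q, ⟨rfl, rfl⟩ | ⟨rfl, rfl⟩, rfl⟩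
      · exact Or.inl rfl
      · exact Or.inr rfl
    · rintro (rfl | rfl)
      · exact ⟨_, _, Or.inl ⟨rfl, rfl⟩, rfl⟩
      · exact ⟨_, _, Or.inr ⟨rfl, rfl⟩, rfl⟩
  refine ncard_goodVecs_of_eq_range ((hG i j).2 (Or.inl rfl))
    (linearIndependent_pair_eVec hic hcj (by rw [ne_eq, Sym2.eq_iff]; grind only)) hgood ?_
  rw [hgood, ← eVec_add_eVec i c j]
  exact add_mem (Submodule.subset_span ⟨0, rfl⟩) (Submodule.subset_span ⟨1, rfl⟩)

theorem ncard_goodVecs_of_square {n : ℕ} {G : SimpleGraph (Fin n)} {i y x j : Fin n}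
    (hiy : i ≠ y) (hix : i ≠ x) (hij : i ≠ j) (hyx : y ≠ x) (hyj : y ≠ j) (hxj : x ≠ j)
    (hG : ∀ p q, G.Adj p q ↔
      s(p, q) = s(i, j) ∨ s(p, q) = s(i, y) ∨ s(p, q) = s(y, x) ∨ s(p, q) = s(x, j)) :
    (goodVecs G i j).ncard = Module.finrank ℝ (Submodule.span ℝ (arcVecs G)) := by
  have hgood : goodVecs G i j = Set.range ![eVec i y, eVec y x, eVec x j] := by
    have key : ∀ p q, GoodArc G i j p q ↔
        (p = i ∧ q = y) ∨ (p = y ∧ q = x) ∨ (p = x ∧ q = j) := by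
      intro p q
      simp only [Sym2.eq_iff] at hG
      constructor
      · rintro ⟨h1, h2, h3, h4⟩
        simp only [BadArc, not_or, not_and, not_exists] at h4
        have h5 := h4.1
        have h6 := h4.2.1
        have h5y := fun h => (h5 h).2 y hyj
        have h6x := fun h => (h6 h).2 x hix.symm
        replace h4 := h4.2.2
        clear h5 h6
        simp only [hG] at *
        grind only
      · intro h
        simp only [GoodArc, BadArc, hG]
        rcases h with ⟨rfl, rfl⟩ | ⟨rfl, rfl⟩ | ⟨rfl, rfl⟩ <;> grind only
    ext x
    simp only [goodVecs, key, Set.mem_ofPred_eq, Matrix.range_cons, Matrix.range_empty,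
      Set.union_empty, Set.mem_union, Set.mem_singleton_iff]
    constructor
    · rintro ⟨p, q, ⟨rfl, rfl⟩ | ⟨rfl, rfl⟩ | ⟨rfl, rfl⟩, rfl⟩
      · exact Or.inl rfl
      · exact Or.inr (Or.inl rfl)
      · exact Or.inr (Or.inr rfl)
    · rintro (rfl | rfl | rfl)
      · exact ⟨_, _, Or.inl ⟨rfl, rfl⟩, rfl⟩
      · exact ⟨_, _, Or.inr (Or.inl ⟨rfl, rfl⟩), rfl⟩
      · exact ⟨_, _, Or.inr (Or.inr ⟨rfl, rfl⟩), rfl⟩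
  refine ncard_goodVecs_of_eq_range ((hG i j).2 (Or.inl rfl))
    (linearIndependent_eVec_path hiy hix hij hyx hyj hxj) hgood ?_
  rw [hgood, ← eVec_add_eVec i y j, ← eVec_add_eVec y x j]
  exact add_mem (Submodule.subset_span ⟨0, rfl⟩)
    (add_mem (Submodule.subset_span ⟨1, rfl⟩) (Submodule.subset_span ⟨2, rfl⟩))

theorem nonempty_induce_support_iso_iff {V W : Type*} (G : SimpleGraph V) {H : SimpleGraph W}
    (hH : ∀ p, ∃ q, H.Adj p q) :
    Nonempty (G.induce G.support ≃g H) ↔ ∃ f : W → V, Function.Injective f ∧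
      ∀ x y, G.Adj x y ↔ ∃ p q, H.Adj p q ∧ f p = x ∧ f q = y := by
  constructor
  · rintro ⟨φ⟩
    refine ⟨fun p => φ.symm p, Subtype.val_injective.comp φ.symm.injective, fun x y => ?_⟩
    constructor
    · intro h
      refine ⟨φ ⟨x, y, h⟩, φ ⟨y, x, h.symm⟩, φ.map_adj_iff.2 h, ?_, ?_⟩ <;> simp
    · rintro ⟨p, q, h, rfl, rfl⟩
      exact φ.symm.map_adj_iff.2 h
  · rintro ⟨f, hf, hG⟩
    have hadj : ∀ p q, G.Adj (f p) (f q) ↔ H.Adj p q := by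
      intro p q
      rw [hG]
      constructor
      · rintro ⟨p', q', h, h1, h2⟩
        rwa [← hf h1, ← hf h2]
      · exact fun h => ⟨p, q, h, rfl, rfl⟩
    have hmem : ∀ p, f p ∈ G.support := fun p => by
      obtain ⟨q, h⟩ := hH p
      exact ⟨f q, (hadj p q).2 h⟩
    refine ⟨RelIso.symm ⟨Equiv.ofBijective (fun p => (⟨f p, hmem p⟩ : G.support)) ⟨?_, ?_⟩, ?_⟩⟩
    · exact fun p q h => hf (congrArg Subtype.val h)
    · rintro ⟨x, y, h⟩
      obtain ⟨p, q, -, rfl, rfl⟩ := (hG x y).1 h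
      exact ⟨p, rfl⟩
    · intro p q
      exact hadj p q

theorem twoDisjointEdges_adj {p q : Fin 4} : twoDisjointEdges.Adj p q ↔
    (p = 0 ∧ q = 1) ∨ (p = 1 ∧ q = 0) ∨ (p = 2 ∧ q = 3) ∨ (p = 3 ∧ q = 2) := by
  simp only [twoDisjointEdges, SimpleGraph.fromEdgeSet_adj, Set.mem_insert_iff,
    Set.mem_singleton_iff, Sym2.eq_iff]
  revert p q
  decide

theorem pathGraph_two_adj {p q : Fin 2} : (SimpleGraph.pathGraph 2).Adj p q ↔
    (p = 0 ∧ q = 1) ∨ (p = 1 ∧ q = 0) := by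
  rw [SimpleGraph.pathGraph_adj]
  revert p q
  decide

theorem pathGraph_three_adj {p q : Fin 3} : (SimpleGraph.pathGraph 3).Adj p q ↔
    (p = 0 ∧ q = 1) ∨ (p = 1 ∧ q = 0) ∨ (p = 1 ∧ q = 2) ∨ (p = 2 ∧ q = 1) := by
  rw [SimpleGraph.pathGraph_adj]
  revert p q
  decide

theorem cycleGraph_three_adj {p q : Fin 3} : (SimpleGraph.cycleGraph 3).Adj p q ↔
    (p = 0 ∧ q = 1) ∨ (p = 1 ∧ q = 0) ∨ (p = 1 ∧ q = 2) ∨ (p = 2 ∧ q = 1) ∨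
    (p = 2 ∧ q = 0) ∨ (p = 0 ∧ q = 2) := by
  revert p q
  decide

theorem cycleGraph_four_adj {p q : Fin 4} : (SimpleGraph.cycleGraph 4).Adj p q ↔
    (p = 0 ∧ q = 1) ∨ (p = 1 ∧ q = 0) ∨ (p = 1 ∧ q = 2) ∨ (p = 2 ∧ q = 1) ∨
    (p = 2 ∧ q = 3) ∨ (p = 3 ∧ q = 2) ∨ (p = 3 ∧ q = 0) ∨ (p = 0 ∧ q = 3) := by
  revert p q
  decide

section Characterizations

variable {n : ℕ} {G : SimpleGraph (Fin n)}

theorem nonempty_iso_pathGraph_two_iff : Nonempty (G.induce G.support ≃g SimpleGraph.pathGraph 2) ↔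
    ∃ i j, i ≠ j ∧ ∀ p q, G.Adj p q ↔ s(p, q) = s(i, j) := by
  rw [nonempty_induce_support_iso_iff G (by simp only [pathGraph_two_adj]; decide)]
  simp only [pathGraph_two_adj, Sym2.eq_iff]
  constructor
  · rintro ⟨f, hf, hG⟩
    have h01 := hf.ne (show (0 : Fin 2) ≠ 1 by decide)
    exact ⟨f 0, f 1, h01, by grind⟩
  · rintro ⟨i, j, hij, hG⟩
    refine ⟨![i, j], ?_, fun p q => ?_⟩
    · intro p q
      fin_cases p <;> fin_cases q <;> simp <;> grind
    · simp [hG, Fin.exists_fin_two]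
      grind

theorem nonempty_iso_two_edges_iff :
    (Nonempty (G.induce G.support ≃g twoDisjointEdges) ∨
      Nonempty (G.induce G.support ≃g SimpleGraph.pathGraph 3)) ↔
    ∃ i j k l, i ≠ j ∧ k ≠ l ∧ s(k, l) ≠ s(i, j) ∧
      ∀ p q, G.Adj p q ↔ s(p, q) = s(i, j) ∨ s(p, q) = s(k, l) := by
  rw [nonempty_induce_support_iso_iff G (by simp only [twoDisjointEdges_adj]; decide),
    nonempty_induce_support_iso_iff G (by simp only [pathGraph_three_adj]; decide)]
  simp only [twoDisjointEdges_adj, pathGraph_three_adj, ne_eq, Sym2.eq_iff]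
  constructor
  · rintro (⟨f, hf, hG⟩ | ⟨f, hf, hG⟩)
    · have h01 := hf.ne (show (0 : Fin 4) ≠ 1 by decide)
      have h23 := hf.ne (show (2 : Fin 4) ≠ 3 by decide)
      have h02 := hf.ne (show (0 : Fin 4) ≠ 2 by decide)
      have h03 := hf.ne (show (0 : Fin 4) ≠ 3 by decide)
      exact ⟨f 0, f 1, f 2, f 3, h01, h23, by grind, by grind⟩
    · have h01 := hf.ne (show (0 : Fin 3) ≠ 1 by decide)
      have h12 := hf.ne (show (1 : Fin 3) ≠ 2 by decide)
      have h02 := hf.ne (show (0 : Fin 3) ≠ 2 by decide)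
      exact ⟨f 0, f 1, f 1, f 2, h01, h12, by grind, by grind⟩
  · rintro ⟨i, j, k, l, hij, hkl, hne, hG⟩
    have path : ∀ a b c : Fin n, a ≠ b → b ≠ c → a ≠ c →
        (∀ p q, G.Adj p q ↔ (p = a ∧ q = b ∨ p = b ∧ q = a) ∨ p = b ∧ q = c ∨ p = c ∧ q = b) →
        ∃ f : Fin 3 → Fin n, Function.Injective f ∧ ∀ x y, G.Adj x y ↔ ∃ p q,
          ((p = 0 ∧ q = 1) ∨ (p = 1 ∧ q = 0) ∨ (p = 1 ∧ q = 2) ∨ (p = 2 ∧ q = 1)) ∧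
            f p = x ∧ f q = y := by
      intro a b c hab hbc hac hG
      refine ⟨![a, b, c], ?_, fun p q => ?_⟩
      · intro p q
        fin_cases p <;> fin_cases q <;> simp <;> grind
      · simp [hG, Fin.exists_fin_succ]
        grind
    by_cases h1 : i = k
    · exact Or.inr (path j i l (by grind) (by grind) (by grind) (by grind))
    by_cases h2 : i = l
    · exact Or.inr (path j i k (by grind) (by grind) (by grind) (by grind))
    by_cases h3 : j = k
    · exact Or.inr (path i j l (by grind) (by grind) (by grind) (by grind))
    by_cases h4 : j = l
    · exact Or.inr (path i j k (by grind) (by grind) (by grind) (by grind))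
    refine Or.inl ⟨![i, j, k, l], ?_, fun p q => ?_⟩
    · intro p q
      fin_cases p <;> fin_cases q <;> simp <;> grind
    · simp [hG, Fin.exists_fin_succ]
      grind

theorem nonempty_iso_cycleGraph_three_iff :
    Nonempty (G.induce G.support ≃g SimpleGraph.cycleGraph 3) ↔
    ∃ i j c, i ≠ j ∧ i ≠ c ∧ c ≠ j ∧
      ∀ p q, G.Adj p q ↔ s(p, q) = s(i, j) ∨ s(p, q) = s(i, c) ∨ s(p, q) = s(c, j) := by
  rw [nonempty_induce_support_iso_iff G (by decide)]
  simp only [cycleGraph_three_adj, Sym2.eq_iff]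
  constructor
  · rintro ⟨f, hf, hG⟩
    have h01 := hf.ne (show (0 : Fin 3) ≠ 1 by decide)
    have h12 := hf.ne (show (1 : Fin 3) ≠ 2 by decide)
    have h02 := hf.ne (show (0 : Fin 3) ≠ 2 by decide)
    exact ⟨f 0, f 2, f 1, h02, h01, h12, by grind⟩
  · rintro ⟨i, j, c, hij, hic, hcj, hG⟩
    refine ⟨![i, c, j], ?_, fun p q => ?_⟩
    · intro p q
      fin_cases p <;> fin_cases q <;> simp <;> grind
    · simp [hG, Fin.exists_fin_succ]
      grind

theorem nonempty_iso_cycleGraph_four_iff :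
    Nonempty (G.induce G.support ≃g SimpleGraph.cycleGraph 4) ↔
    ∃ i y x j, i ≠ y ∧ i ≠ x ∧ i ≠ j ∧ y ≠ x ∧ y ≠ j ∧ x ≠ j ∧
      ∀ p q, G.Adj p q ↔
        s(p, q) = s(i, j) ∨ s(p, q) = s(i, y) ∨ s(p, q) = s(y, x) ∨ s(p, q) = s(x, j) := by
  rw [nonempty_induce_support_iso_iff G (by decide)]
  simp only [cycleGraph_four_adj, Sym2.eq_iff]
  constructor
  · rintro ⟨f, hf, hG⟩
    refine ⟨f 0, f 1, f 2, f 3, hf.ne (by decide), hf.ne (by decide), hf.ne (by decide),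
      hf.ne (by decide), hf.ne (by decide), hf.ne (by decide), fun p q => ?_⟩
    rw [hG]
    constructor
    · rintro ⟨u, w, h, rfl, rfl⟩
      rcases h with ⟨rfl, rfl⟩ | ⟨rfl, rfl⟩ | ⟨rfl, rfl⟩ | ⟨rfl, rfl⟩ | ⟨rfl, rfl⟩ |
        ⟨rfl, rfl⟩ | ⟨rfl, rfl⟩ | ⟨rfl, rfl⟩ <;>
        simp only [true_and, and_true, and_self, true_or, or_true]
    · rintro ((⟨rfl, rfl⟩ | ⟨rfl, rfl⟩) | (⟨rfl, rfl⟩ | ⟨rfl, rfl⟩) |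
        (⟨rfl, rfl⟩ | ⟨rfl, rfl⟩) | (⟨rfl, rfl⟩ | ⟨rfl, rfl⟩)) <;>
        exact ⟨_, _, by decide, rfl, rfl⟩
  · rintro ⟨i, y, x, j, hiy, hix, hij, hyx, hyj, hxj, hG⟩
    refine ⟨![i, y, x, j], ?_, fun p q => ?_⟩
    · intro p q
      fin_cases p <;> fin_cases q <;> simp <;> grind
    · simp [hG, Fin.exists_fin_succ]
      grind

end Characterizations

theorem isSimplePolytope_of_ncard_goodVecs {n : ℕ} {G : SimpleGraph (Fin n)}
    {i j k l : Fin n} (hij : G.Adj i j) (hkl : G.Adj k l) (hne : s(k, l) ≠ s(i, j))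
    (h : ∀ i j, G.Adj i j →
      (goodVecs G i j).ncard = Module.finrank ℝ (Submodule.span ℝ (arcVecs G))) :
    IsSimplePolytope (symEdgePolytope G) := by
  intro v hv
  obtain ⟨p, q, hpq, rfl⟩ := hv.mem_arcVecs ⟨_, i, j, hij, rfl⟩
  have hw : ∃ u w, G.Adj u w ∧ s(u, w) ≠ s(p, q) := by
    by_cases h : s(i, j) = s(p, q)
    · exact ⟨k, l, hkl, by rwa [← h]⟩
    · exact ⟨i, j, hij, h⟩
  obtain ⟨u, w, huw, hne⟩ := hw
  rw [ncard_isEdgeOfPolytope hpq, polyDim_symEdgePolytope, h p q hpq]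
  refine ⟨eVec u w, ⟨u, w, huw, rfl⟩, fun h => hne ?_, fun h => hne ?_⟩
  · obtain ⟨rfl, rfl⟩ := eVec_inj huw.ne h
    rfl
  · rw [neg_eVec] at h
    obtain ⟨rfl, rfl⟩ := eVec_inj huw.ne h
    exact Sym2.eq_swap

theorem IsSimplePolytope.ncard_goodVecs {n : ℕ} {G : SimpleGraph (Fin n)}
    (h : IsSimplePolytope (symEdgePolytope G)) {i j k l : Fin n} (hij : G.Adj i j)
    (hkl : G.Adj k l) (hne : s(k, l) ≠ s(i, j)) :
    (goodVecs G i j).ncard = Module.finrank ℝ (Submodule.span ℝ (arcVecs G)) := by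
  rw [← polyDim_symEdgePolytope, ← h _ (isVertexOfPolytope_eVec hij), ncard_isEdgeOfPolytope hij]
  refine ⟨eVec k l, ⟨k, l, hkl, rfl⟩, fun h => hne ?_, fun h => hne ?_⟩
  · obtain ⟨rfl, rfl⟩ := eVec_inj hkl.ne h
    rfl
  · rw [neg_eVec] at h
    obtain ⟨rfl, rfl⟩ := eVec_inj hkl.ne h
    exact Sym2.eq_swap

theorem isSimplePolytope_of_single_edge {n : ℕ} {G : SimpleGraph (Fin n)} {i j : Fin n}
    (hG : ∀ p q, G.Adj p q ↔ s(p, q) = s(i, j)) : IsSimplePolytope (symEdgePolytope G) := by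
  refine isSimplePolytope_of_forall_adj ((hG i j).2 rfl) ?_
  rintro _ ⟨p, q, hpq, rfl⟩
  rcases Sym2.eq_iff.1 ((hG p q).1 hpq) with ⟨rfl, rfl⟩ | ⟨rfl, rfl⟩
  · exact Or.inl rfl
  · exact Or.inr (neg_eVec _ _).symm

theorem isSimplePolytope_of_two_edges {n : ℕ} {G : SimpleGraph (Fin n)} {i j k l : Fin n}
    (hij : i ≠ j) (hkl : k ≠ l) (hne : s(k, l) ≠ s(i, j))
    (hG : ∀ p q, G.Adj p q ↔ s(p, q) = s(i, j) ∨ s(p, q) = s(k, l)) :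
    IsSimplePolytope (symEdgePolytope G) := by
  refine isSimplePolytope_of_ncard_goodVecs ((hG i j).2 (Or.inl rfl)) ((hG k l).2 (Or.inr rfl))
    hne fun p q hpq => ?_
  rcases (hG p q).1 hpq with h | h
  · exact ncard_goodVecs_of_two_edges hpq.ne hkl (by rwa [h]) (by rwa [h])
  · refine ncard_goodVecs_of_two_edges hpq.ne hij (by rw [h]; exact hne.symm) ?_
    simpa only [h, or_comm] using hG

theorem isSimplePolytope_of_triangle {n : ℕ} {G : SimpleGraph (Fin n)} {i j c : Fin n}
    (hij : i ≠ j) (hic : i ≠ c) (hcj : c ≠ j)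
    (hG : ∀ p q, G.Adj p q ↔ s(p, q) = s(i, j) ∨ s(p, q) = s(i, c) ∨ s(p, q) = s(c, j)) :
    IsSimplePolytope (symEdgePolytope G) := by
  refine isSimplePolytope_of_ncard_goodVecs ((hG i j).2 (Or.inl rfl))
    ((hG i c).2 (Or.inr (Or.inl rfl))) (by rw [ne_eq, Sym2.eq_iff]; grind only) fun p q hpq => ?_
  simp only [Sym2.eq_iff] at hG
  have key : ∃ r, p ≠ r ∧ r ≠ q ∧ ∀ u w, G.Adj u w ↔
      s(u, w) = s(p, q) ∨ s(u, w) = s(p, r) ∨ s(u, w) = s(r, q) := by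
    simp only [Sym2.eq_iff]
    rcases (hG p q).1 hpq with (⟨rfl, rfl⟩ | ⟨rfl, rfl⟩) | (⟨rfl, rfl⟩ | ⟨rfl, rfl⟩) |
      (⟨rfl, rfl⟩ | ⟨rfl, rfl⟩)
    · exact ⟨c, by grind only⟩
    · exact ⟨c, by grind only⟩
    · exact ⟨j, by grind only⟩
    · exact ⟨j, by grind only⟩
    · exact ⟨i, by grind only⟩
    · exact ⟨i, by grind only⟩
  obtain ⟨r, h1, h2, h3⟩ := key
  exact ncard_goodVecs_of_triangle hpq.ne h1 h2 h3

theorem isSimplePolytope_of_square {n : ℕ} {G : SimpleGraph (Fin n)} {i y x j : Fin n}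
    (hiy : i ≠ y) (hix : i ≠ x) (hij : i ≠ j) (hyx : y ≠ x) (hyj : y ≠ j) (hxj : x ≠ j)
    (hG : ∀ p q, G.Adj p q ↔
      s(p, q) = s(i, j) ∨ s(p, q) = s(i, y) ∨ s(p, q) = s(y, x) ∨ s(p, q) = s(x, j)) :
    IsSimplePolytope (symEdgePolytope G) := by
  refine isSimplePolytope_of_ncard_goodVecs ((hG i j).2 (Or.inl rfl))
    ((hG i y).2 (Or.inr (Or.inl rfl))) (by rw [ne_eq, Sym2.eq_iff]; grind only) fun p q hpq => ?_
  simp only [Sym2.eq_iff] at hG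
  have key : ∃ r t, p ≠ r ∧ p ≠ t ∧ r ≠ t ∧ r ≠ q ∧ t ≠ q ∧ ∀ u w, G.Adj u w ↔
      s(u, w) = s(p, q) ∨ s(u, w) = s(p, r) ∨ s(u, w) = s(r, t) ∨ s(u, w) = s(t, q) := by
    simp only [Sym2.eq_iff]
    rcases (hG p q).1 hpq with (⟨rfl, rfl⟩ | ⟨rfl, rfl⟩) | (⟨rfl, rfl⟩ | ⟨rfl, rfl⟩) |
      (⟨rfl, rfl⟩ | ⟨rfl, rfl⟩) | (⟨rfl, rfl⟩ | ⟨rfl, rfl⟩)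
    · exact ⟨y, x, by grind only⟩
    · exact ⟨x, y, by grind only⟩
    · exact ⟨j, x, by grind only⟩
    · exact ⟨x, j, by grind only⟩
    · exact ⟨i, j, by grind only⟩
    · exact ⟨j, i, by grind only⟩
    · exact ⟨y, i, by grind only⟩
    · exact ⟨i, y, by grind only⟩
  obtain ⟨r, t, h1, h2, h3, h4, h5, h6⟩ := key
  exact ncard_goodVecs_of_square h1 h2 hpq.ne h3 h4 h5 h6

open Filter in
theorem stmt1 {n : ℕ} (G : SimpleGraph (Fin n)) (hE : ∃ i j, G.Adj i j) :
    IsSimplePolytope (symEdgePolytope G) ↔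
      (Nonempty (G.induce G.support ≃g SimpleGraph.pathGraph 2) ∨
        Nonempty (G.induce G.support ≃g twoDisjointEdges) ∨
        Nonempty (G.induce G.support ≃g SimpleGraph.pathGraph 3) ∨
        Nonempty (G.induce G.support ≃g SimpleGraph.cycleGraph 3) ∨
        Nonempty (G.induce G.support ≃g SimpleGraph.cycleGraph 4)) := by
  rw [← or_assoc (a := Nonempty (G.induce G.support ≃g twoDisjointEdges)),
    nonempty_iso_pathGraph_two_iff, nonempty_iso_two_edges_iff,
    nonempty_iso_cycleGraph_three_iff, nonempty_iso_cycleGraph_four_iff]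
  constructor
  · intro hsimple
    obtain ⟨i, j, hij⟩ := hE
    by_cases hone : ∀ k l, G.Adj k l → s(k, l) = s(i, j)
    · refine Or.inl ⟨i, j, hij.ne, fun p q => ⟨hone p q, fun h => ?_⟩⟩
      rw [← SimpleGraph.mem_edgeSet, h]
      exact hij
    push Not at hone
    obtain ⟨k, l, hkl, hne⟩ := hone
    rcases adj_iff_of_ncard_goodVecs hij (hsimple.ncard_goodVecs hij hkl hne) hkl hne with
      h | ⟨c, h1, h2, h⟩ | ⟨y, x, h1, h2, h3, h4, h5, h⟩
    · exact Or.inr (Or.inl ⟨i, j, k, l, hij.ne, hkl.ne, hne, h⟩)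
    · exact Or.inr (Or.inr (Or.inl ⟨i, j, c, hij.ne, h1.ne, h2.ne, h⟩))
    · exact Or.inr (Or.inr (Or.inr
        ⟨i, y, x, j, h1.ne, h5.symm, hij.ne, h2.ne, h4, h3.ne, h⟩))
  · rintro (⟨i, j, -, h⟩ | ⟨i, j, k, l, h1, h2, h3, h⟩ | ⟨i, j, c, h1, h2, h3, h⟩ |
      ⟨i, y, x, j, h1, h2, h3, h4, h5, h6, h⟩)
    · exact isSimplePolytope_of_single_edge h
    · exact isSimplePolytope_of_two_edges h1 h2 h3 h
    · exact isSimplePolytope_of_triangle h1 h2 h3 h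
    · exact isSimplePolytope_of_square h1 h2 h3 h4 h5 h6 h

end SEP
end

section
/- Let G be a finite simple graph and let G_1,…,G_k be its 2-connected components, i.e., the inclusion-maximal subgraphs of G that are either 2-connected or consist of a single edge. Then cy(G) = Σ_{i=1}^k cy(G_i), and for every total order < on the edge set of G with restrictions <_i to the edge sets of the G_i one has n_1(G,<) = Σ_{i=1}^k n_1(G_i,<_i), and consequently γ₂(G,<) = Σ_{i=1}^k γ₂(G_i,<_i) + 4·Σ_{1≤i<j≤k} cy(G_i)·cy(G_j) ≥ Σ_{i=1}^k γ₂(G_i,<_i). -/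
open SimpleGraph Finset Filter

namespace SEP

section Counting

theorem ncard_eq_sum_ncard {α ι : Type*} [Fintype ι] {β : ι → Type*} [∀ i, Finite (β i)]
    (A : Set α) (C : ∀ i, Set (β i)) (f : ∀ i, β i → α) (hf : ∀ i, Function.Injective (f i))
    (hmaps : ∀ i, ∀ x ∈ C i, f i x ∈ A) (hsurj : ∀ a ∈ A, ∃ i, ∃ x ∈ C i, f i x = a)
    (huniq : ∀ i j, ∀ x ∈ C i, ∀ y ∈ C j, f i x = f j y → i = j) :
    A.ncard = ∑ i, (C i).ncard := by
  let g : (Σ i, C i) → A := fun p => ⟨f p.1 p.2.1, hmaps _ _ p.2.2⟩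
  have hg : Function.Bijective g := by
    constructor
    · rintro ⟨i, x, hx⟩ ⟨j, y, hy⟩ h
      have h' : f i x = f j y := congrArg Subtype.val h
      obtain rfl := huniq i j x hx y hy h'
      obtain rfl := hf i h'
      rfl
    · rintro ⟨a, ha⟩
      obtain ⟨i, x, hx, rfl⟩ := hsurj a ha
      exact ⟨⟨i, x, hx⟩, rfl⟩
  rw [← Nat.card_coe_set_eq, ← Nat.card_eq_of_bijective g hg, Nat.card_sigma]
  simp only [Nat.card_coe_set_eq]

theorem edgeSet_ncard_eq_sum {V ι : Type*} [Finite V] [Fintype ι] (F : SimpleGraph V)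
    (S : ι → Set V) (hex : ∀ u v, F.Adj u v → ∃ i, u ∈ S i ∧ v ∈ S i)
    (huniq : ∀ u v, F.Adj u v → ∀ i j, u ∈ S i → v ∈ S i → u ∈ S j → v ∈ S j → i = j) :
    F.edgeSet.ncard = ∑ i, (F.induce (S i)).edgeSet.ncard := by
  refine ncard_eq_sum_ncard F.edgeSet (fun i => (F.induce (S i)).edgeSet)
    (fun i => Sym2.map Subtype.val) (fun i => Sym2.map.injective Subtype.val_injective) ?_ ?_ ?_
  · rintro i ⟨u, v⟩ h
    exact h
  · rintro ⟨u, v⟩ h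
    obtain ⟨i, hu, hv⟩ := hex u v h
    exact ⟨i, s(⟨u, hu⟩, ⟨v, hv⟩), h, rfl⟩
  · rintro i j ⟨⟨u, hu⟩, ⟨v, hv⟩⟩ h ⟨⟨u', hu'⟩, ⟨v', hv'⟩⟩ - he
    have he' : s(u, v) = s(u', v') := he
    rw [Sym2.eq_iff] at he'
    rcases he' with ⟨rfl, rfl⟩ | ⟨rfl, rfl⟩
    · exact huniq u v h i j hu hv hu' hv'
    · exact huniq u v h i j hu hv hv' hu'

theorem IsTree.edgeSet_ncard_add_one {V : Type*} [Finite V] {T : SimpleGraph V} (hT : T.IsTree) :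
    T.edgeSet.ncard + 1 = Nat.card V := by
  classical
  have := Fintype.ofFinite V
  rw [Nat.card_eq_fintype_card, ← hT.card_edgeFinset, ← SimpleGraph.coe_edgeFinset,
    Set.ncard_coe_finset]

theorem cyc_eq_zero_of_isAcyclic {V : Type*} [Finite V] {F : SimpleGraph V} (hF : F.IsAcyclic) :
    cyc F = 0 := by
  classical
  have := Fintype.ofFinite V
  have := Fintype.ofFinite F.ConnectedComponent
  have hE := edgeSet_ncard_eq_sum F (fun C : F.ConnectedComponent => C.supp)
    (fun u v h => ⟨F.connectedComponentMk u, rfl,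
      SimpleGraph.ConnectedComponent.eq.2 h.symm.reachable⟩)
    (fun u v _ C D hC _ hD _ => SimpleGraph.ConnectedComponent.eq_of_common_vertex hC hD)
  have hV : (Set.univ : Set V).ncard = ∑ C : F.ConnectedComponent, (Set.univ : Set C.supp).ncard :=
    ncard_eq_sum_ncard _ _ (fun _ => Subtype.val) (fun _ => Subtype.val_injective)
      (fun _ _ _ => trivial)
      (fun v _ => ⟨F.connectedComponentMk v, ⟨v, rfl⟩, trivial, rfl⟩)
      (fun C D x _ y _ h => SimpleGraph.ConnectedComponent.eq_of_common_vertex x.2 (h ▸ y.2))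
  have hT : ∀ C : F.ConnectedComponent,
      (Set.univ : Set C.supp).ncard = (F.induce C.supp).edgeSet.ncard + 1 := fun C => by
    rw [Set.ncard_univ]
    exact (IsTree.edgeSet_ncard_add_one (hF.isTree_connectedComponent C)).symm
  rw [Set.ncard_univ, Finset.sum_congr rfl (fun C _ => hT C), Finset.sum_add_distrib] at hV
  simp only [Finset.sum_const, Finset.card_univ, smul_eq_mul, mul_one] at hV
  rw [cyc, hV, hE, Nat.card_eq_fintype_card]
  push_cast
  ring

theorem cyc_eq_sub_of_spanningForest {V : Type*} [Finite V] {F G : SimpleGraph V}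
    (hF : F.IsAcyclic) (hr : F.Reachable = G.Reachable) :
    cyc G = (G.edgeSet.ncard : ℤ) - F.edgeSet.ncard := by
  have h0 := cyc_eq_zero_of_isAcyclic hF
  have hc : Nat.card F.ConnectedComponent = Nat.card G.ConnectedComponent := by
    unfold SimpleGraph.ConnectedComponent
    rw [hr]
  unfold cyc at *
  rw [← hc]
  linarith

end Counting

section Nonseparable

/-- A set of at least two vertices inducing a connected subgraph without cut vertices. -/
structure IsNonseparable {V : Type*} (G : SimpleGraph V) (S : Set V) : Prop where
  nontrivial : S.Nontrivial
  preconnected : (G.induce S).Preconnected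
  diff_preconnected : ∀ x, (G.induce (S \ {x})).Preconnected

variable {V : Type*} {G : SimpleGraph V} {S T : Set V}

theorem reachable_induce_of_walk {u v : V} (w : G.Walk u v) (hw : ∀ x ∈ w.support, x ∈ S)
    (hu : u ∈ S) (hv : v ∈ S) : (G.induce S).Reachable ⟨u, hu⟩ ⟨v, hv⟩ :=
  (w.induce S hw).reachable

theorem IsNonseparable.union (hS : IsNonseparable G S) (hT : IsNonseparable G T)
    (h : (S ∩ T).Nontrivial) : IsNonseparable G (S ∪ T) where
  nontrivial := hS.nontrivial.mono Set.subset_union_left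
  preconnected := (SimpleGraph.induce_union_connected hS.preconnected hT.preconnected
    h.nonempty).preconnected
  diff_preconnected x := by
    obtain ⟨y, hy, hyx⟩ := h.exists_ne x
    rw [Set.union_sdiff_distrib]
    exact (SimpleGraph.induce_union_connected (hS.diff_preconnected x) (hT.diff_preconnected x)
      ⟨y, ⟨hy.1, hyx⟩, hy.2, hyx⟩).preconnected

theorem isNonseparable_support_of_isPath {u v : V} {p : G.Walk u v} (hp : p.IsPath)
    (huv : G.Adj u v) : IsNonseparable G {x | x ∈ p.support} where
  nontrivial := ⟨u, p.start_mem_support, v, p.end_mem_support, huv.ne⟩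
  preconnected := p.connected_induce_support.preconnected
  diff_preconnected x := by
    classical
    set D := {x | x ∈ p.support} \ {x} with hD
    have key : ∀ y : D, (∃ hu : u ∈ D, (G.induce D).Reachable y ⟨u, hu⟩) ∨
        ∃ hv : v ∈ D, (G.induce D).Reachable y ⟨v, hv⟩ := by
      rintro ⟨y, hy, hyx⟩
      by_cases hx : x ∈ (p.takeUntil y hy).support
      · right
        have hx' : x ∉ (p.dropUntil y hy).support := fun hx' =>
          SimpleGraph.Walk.IsPath.ne_of_mem_support_of_append
            (p := p.takeUntil y hy) (q := p.dropUntil y hy) (by simpa using hp)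
            (Ne.symm hyx) hx hx' rfl
        have hw : ∀ z ∈ (p.dropUntil y hy).support, z ∈ D := fun z hz =>
          ⟨p.support_dropUntil_subset_support hy hz, fun h => hx' (h ▸ hz)⟩
        exact ⟨hw _ (SimpleGraph.Walk.end_mem_support _), reachable_induce_of_walk _ hw _ _⟩
      · left
        have hw : ∀ z ∈ (p.takeUntil y hy).support, z ∈ D := fun z hz =>
          ⟨p.support_takeUntil_subset_support hy hz, fun h => hx (h ▸ hz)⟩
        exact ⟨hw _ (SimpleGraph.Walk.start_mem_support _),
          (reachable_induce_of_walk _ hw _ _).symm⟩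
    have huv' : ∀ (hu : u ∈ D) (hv : v ∈ D), (G.induce D).Reachable ⟨u, hu⟩ ⟨v, hv⟩ :=
      fun hu hv => SimpleGraph.Adj.reachable (by simpa using huv)
    intro y z
    rcases key y with ⟨hu, hy⟩ | ⟨hv, hy⟩ <;> rcases key z with ⟨hu', hz⟩ | ⟨hv', hz⟩
    · exact hy.trans hz.symm
    · exact hy.trans ((huv' _ _).trans hz.symm)
    · exact hy.trans ((huv' _ _).symm.trans hz.symm)
    · exact hy.trans hz.symm

theorem isNonseparable_pair {u v : V} (h : G.Adj u v) : IsNonseparable G {u, v} := by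
  have := isNonseparable_support_of_isPath (p := h.toWalk) (by simp [h.ne]) h
  convert this using 1
  ext x
  simp

theorem isNonseparable_verts {H : G.Subgraph} (h : TwoConnected H.coe ∨ IsSingleEdge G H) :
    IsNonseparable G H.verts := by
  rcases h with ⟨hc, hcard, hdel⟩ | ⟨u, v, huv, rfl⟩
  · refine ⟨?_, ?_, fun x => ?_⟩
    · have : Nontrivial H.verts :=
        have := Nat.finite_of_card_ne_zero (α := H.verts) (by omega)
        Finite.one_lt_card_iff_nontrivial.1 (by omega)
      exact Set.nontrivial_coe_sort.1 this
    · let f : H.coe →g G.induce H.verts := ⟨id, fun h => H.adj_sub h⟩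
      exact hc.preconnected.map f Function.surjective_id
    · by_cases hx : x ∈ H.verts
      · let f : H.coe.induce {u | u ≠ ⟨x, hx⟩} →g G.induce (H.verts \ {x}) :=
          ⟨fun u => ⟨u.1.1, u.1.2, fun h => u.2 (Subtype.ext h)⟩, fun h => H.adj_sub h⟩
        refine (hdel ⟨x, hx⟩).preconnected.map f ?_
        rintro ⟨y, hy, hyx⟩
        exact ⟨⟨⟨y, hy⟩, fun h => hyx (congrArg Subtype.val h)⟩, rfl⟩
      · let f : H.coe →g G.induce (H.verts \ {x}) :=
          ⟨fun u => ⟨u.1, u.2, fun h => hx (h ▸ u.2)⟩, fun h => H.adj_sub h⟩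
        refine hc.preconnected.map f ?_
        rintro ⟨y, hy, hyx⟩
        exact ⟨⟨y, hy⟩, rfl⟩
  · exact isNonseparable_pair huv

theorem IsNonseparable.twoConnected_or_isSingleEdge [Finite V] (h : IsNonseparable G S) :
    TwoConnected ((⊤ : G.Subgraph).induce S).coe ∨
      IsSingleEdge G ((⊤ : G.Subgraph).induce S) := by
  have hlt : 1 < S.ncard := (Set.one_lt_ncard_iff_nontrivial).2 h.nontrivial
  rcases (Nat.succ_le_of_lt hlt).eq_or_lt with h2 | h3
  · right
    obtain ⟨u, v, huv, rfl⟩ := Set.ncard_eq_two.1 h2.symm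
    have hr := h.preconnected ⟨u, by simp⟩ ⟨v, by simp⟩
    have hadj : G.Adj u v := by
      obtain ⟨w⟩ := hr
      cases w with
      | nil => exact (huv rfl).elim
      | @cons _ b _ hb _ =>
        obtain ⟨b, rfl | rfl⟩ := b
        · exact (hb.ne rfl).elim
        · exact hb
    exact ⟨u, v, hadj, (SimpleGraph.Subgraph.subgraphOfAdj_eq_induce hadj).symm⟩
  · left
    have hne : Nonempty ((⊤ : G.Subgraph).induce S).verts := h.nontrivial.nonempty.to_subtype
    let f : G.induce S →g ((⊤ : G.Subgraph).induce S).coe :=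
      ⟨id, fun {a b} h => ⟨a.2, b.2, h⟩⟩
    refine ⟨⟨h.preconnected.map f Function.surjective_id⟩, h3, ?_⟩
    rintro ⟨x, hx⟩
    obtain ⟨y, hy, hyx⟩ := h.nontrivial.exists_ne x
    let g : G.induce (S \ {x}) →g
        ((⊤ : G.Subgraph).induce S).coe.induce {u | u ≠ ⟨x, hx⟩} :=
      ⟨fun u => ⟨⟨u.1, u.2.1⟩, fun h => u.2.2 (congrArg Subtype.val h)⟩,
        fun {a b} h => ⟨a.2.1, b.2.1, h⟩⟩
    have hne' : Nonempty {u : ((⊤ : G.Subgraph).induce S).verts | u ≠ ⟨x, hx⟩} :=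
      ⟨⟨⟨y, hy⟩, fun h => hyx (congrArg Subtype.val h)⟩⟩
    refine ⟨(h.diff_preconnected x).map g ?_⟩
    rintro ⟨⟨z, hz⟩, hzx⟩
    exact ⟨⟨z, hz, fun h => hzx (Subtype.ext h)⟩, rfl⟩

theorem isBlock_iff [Finite V] {H : G.Subgraph} :
    IsBlock G H ↔ Maximal (IsNonseparable G) H.verts ∧ H = (⊤ : G.Subgraph).induce H.verts := by
  constructor
  · rintro ⟨h, hmax⟩
    have hmax' : ∀ T, IsNonseparable G T → H.verts ⊆ T → (⊤ : G.Subgraph).induce T = H :=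
      fun T hT hle => hmax _ (SimpleGraph.Subgraph.le_induce_top_verts.trans
        (SimpleGraph.Subgraph.induce_mono_right hle)) hT.twoConnected_or_isSingleEdge
    refine ⟨⟨isNonseparable_verts h, fun T hT hle => ?_⟩,
      (hmax' _ (isNonseparable_verts h) subset_rfl).symm⟩
    rw [← hmax' T hT hle]
    exact subset_rfl
  · rintro ⟨hmax, hH⟩
    refine ⟨by rw [hH]; exact hmax.prop.twoConnected_or_isSingleEdge, fun H' hle h' => ?_⟩
    have hv : H'.verts = H.verts :=
      (hmax.eq_of_subset (isNonseparable_verts h') (SimpleGraph.Subgraph.verts_mono hle)).symm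
    refine le_antisymm ?_ hle
    rw [hH, ← hv]
    exact SimpleGraph.Subgraph.le_induce_top_verts

theorem IsNonseparable.exists_maximal [Finite V] (h : IsNonseparable G S) :
    ∃ T, S ⊆ T ∧ Maximal (IsNonseparable G) T :=
  (Set.toFinite {T | IsNonseparable G T}).exists_le_maximal h

theorem eq_of_maximal_isNonseparable (hS : Maximal (IsNonseparable G) S)
    (hT : Maximal (IsNonseparable G) T) (h : (S ∩ T).Nontrivial) : S = T := by
  have hU := hS.prop.union hT.prop h
  rw [hS.eq_of_subset hU Set.subset_union_left]
  exact (hT.eq_of_subset hU Set.subset_union_right).symm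

theorem subset_of_maximal_isNonseparable [Finite V] (hS : Maximal (IsNonseparable G) S)
    (hT : IsNonseparable G T) (h : (S ∩ T).Nontrivial) : T ⊆ S := by
  obtain ⟨U, hTU, hU⟩ := hT.exists_maximal
  rw [eq_of_maximal_isNonseparable hS hU (h.mono (Set.inter_subset_inter_right _ hTU))]
  exact hTU

theorem isNonseparable_support_of_isCycle {u : V} {w : G.Walk u u} (hw : w.IsCycle) :
    IsNonseparable G {x | x ∈ w.support} := by
  cases w with
  | nil => simp at hw
  | cons h p =>
    convert isNonseparable_support_of_isPath ((SimpleGraph.Walk.cons_isCycle_iff p h).1 hw).1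
      h.symm using 1
    ext x
    simp only [SimpleGraph.Walk.support_cons, List.mem_cons, Set.mem_ofPred_eq]
    exact ⟨fun hx => hx.elim (fun hx => hx ▸ p.end_mem_support) id, Or.inr⟩

theorem reachable_induce_eq_of_maximal [Finite V] {F : SimpleGraph V} (hle : F ≤ G)
    (hr : F.Reachable = G.Reachable) (hS : Maximal (IsNonseparable G) S) :
    (F.induce S).Reachable = (G.induce S).Reachable := by
  classical
  have hadj : ∀ a b, (G.induce S).Adj a b → (F.induce S).Reachable a b := by
    rintro ⟨a, ha⟩ ⟨b, hb⟩ hab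
    have hab' : G.Adj a b := hab
    have : F.Reachable a b := by rw [hr]; exact hab'.reachable
    obtain ⟨p, hp⟩ := this.exists_isPath
    have hp' : (p.mapLe hle).IsPath := hp.mapLe hle
    have hsub := subset_of_maximal_isNonseparable hS
      (isNonseparable_support_of_isPath hp' hab')
      ⟨a, ⟨ha, (p.mapLe hle).start_mem_support⟩, b, ⟨hb, (p.mapLe hle).end_mem_support⟩, hab'.ne⟩
    exact reachable_induce_of_walk p (fun x hx => hsub (by simpa using hx)) ha hb
  ext a b
  constructor
  · exact fun h => h.mono (fun _ _ h => hle h)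
  · rintro ⟨w⟩
    induction w with
    | nil => rfl
    | cons h _ ih => exact (hadj _ _ h).trans ih

end Nonseparable

section BadPairs

variable {V : Type*} {G : SimpleGraph V} {elt : Sym2 V → Sym2 V → Prop}

/-- The dart of `G` underlying a dart of an induced subgraph. -/
abbrev inducedDart (G : SimpleGraph V) (s : Set V) (d : (G.induce s).Dart) : G.Dart :=
  (SimpleGraph.Embedding.induce s : G.induce s ↪g G).toHom.mapDart d

theorem inducedDart_injective (s : Set V) : Function.Injective (inducedDart G s) := by
  intro a b h
  have h1 : a.fst.1 = b.fst.1 := congrArg (fun d : G.Dart => d.fst) h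
  have h2 : a.snd.1 = b.snd.1 := congrArg (fun d : G.Dart => d.snd) h
  exact SimpleGraph.Dart.ext _ _ (Prod.ext (Subtype.ext h1) (Subtype.ext h2))

theorem badPair_iff_exists_isCycle {a b : G.Dart} :
    BadPair G elt a b ↔ a.edge ≠ b.edge ∧ ∃ (u : V) (w : G.Walk u u), w.IsCycle ∧
      a ∈ w.darts ∧ b ∈ w.darts ∧ (w.length = 3 ∨ w.length = 4 ∧
        (∃ e ∈ w.edges, elt e a.edge) ∧ (∃ e ∈ w.edges, elt e b.edge)) := by
  unfold BadPair dartsInCycle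
  constructor
  · rintro ⟨hab, ⟨u, w, hw, hl, ha, hb⟩ | ⟨u, w, hw, hl, ha, hb, h⟩⟩
    · exact ⟨hab, u, w, hw, ha, hb, Or.inl hl⟩
    · exact ⟨hab, u, w, hw, ha, hb, Or.inr ⟨hl, h⟩⟩
  · rintro ⟨hab, u, w, hw, ha, hb, hl | ⟨hl, h⟩⟩
    · exact ⟨hab, Or.inl ⟨u, w, hw, hl, ha, hb⟩⟩
    · exact ⟨hab, Or.inr ⟨u, w, hw, hl, ha, hb, h⟩⟩

theorem BadPair.inducedDart {s : Set V} {a b : (G.induce s).Dart}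
    (h : BadPair (G.induce s) (restrictOrd elt s) a b) :
    BadPair G elt (inducedDart G s a) (inducedDart G s b) := by
  rw [badPair_iff_exists_isCycle] at h ⊢
  obtain ⟨hab, u, w, hw, ha, hb, hl⟩ := h
  refine ⟨fun he => hab (Sym2.map.injective Subtype.val_injective he), _,
    w.map (SimpleGraph.Embedding.induce s).toHom,
    hw.map Subtype.val_injective, ?_, ?_, ?_⟩
  · rw [SimpleGraph.Walk.darts_map]
    exact List.mem_map_of_mem ha
  · rw [SimpleGraph.Walk.darts_map]
    exact List.mem_map_of_mem hb
  · rw [SimpleGraph.Walk.length_map, SimpleGraph.Walk.edges_map]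
    refine hl.imp_right fun ⟨h4, ⟨e, he, hea⟩, ⟨e', he', heb⟩⟩ => ⟨h4, ?_, ?_⟩
    · exact ⟨_, List.mem_map_of_mem he, hea⟩
    · exact ⟨_, List.mem_map_of_mem he', heb⟩

theorem BadPair.exists_maximal_isNonseparable [Finite V] {a b : G.Dart} (h : BadPair G elt a b) :
    ∃ S, Maximal (IsNonseparable G) S ∧ ∃ a' b',
      BadPair (G.induce S) (restrictOrd elt S) a' b' ∧
        SEP.inducedDart G S a' = a ∧ SEP.inducedDart G S b' = b := by
  rw [badPair_iff_exists_isCycle] at h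
  obtain ⟨hab, u, w, hw, ha, hb, hl⟩ := h
  obtain ⟨S, hwS, hS⟩ := (isNonseparable_support_of_isCycle hw).exists_maximal
  set w' := w.induce S hwS
  have hmap : w'.map (SimpleGraph.Embedding.induce S).toHom = w :=
    SimpleGraph.Walk.map_induce w hwS
  have hdarts : w'.darts.map (SEP.inducedDart G S) = w.darts :=
    (SimpleGraph.Walk.darts_map _ w').symm.trans (congrArg SimpleGraph.Walk.darts hmap)
  have hedges : w'.edges.map (Sym2.map Subtype.val) = w.edges :=
    (SimpleGraph.Walk.edges_map _ w').symm.trans (congrArg SimpleGraph.Walk.edges hmap)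
  have hlen : w'.length = w.length :=
    (SimpleGraph.Walk.length_map _ w').symm.trans (congrArg SimpleGraph.Walk.length hmap)
  have hw' : w'.IsCycle :=
    SimpleGraph.Walk.IsCycle.of_map (f := (SimpleGraph.Embedding.induce S).toHom)
      (hmap.symm ▸ hw :)
  rw [← hdarts] at ha hb
  obtain ⟨a', ha', rfl⟩ := List.mem_map.1 ha
  obtain ⟨b', hb', rfl⟩ := List.mem_map.1 hb
  refine ⟨S, hS, a', b', ?_, rfl, rfl⟩
  rw [badPair_iff_exists_isCycle]
  refine ⟨fun he => hab (congrArg (Sym2.map Subtype.val) he), _, w', hw', ha', hb', ?_⟩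
  rw [← hlen, ← hedges] at hl
  refine hl.imp_right fun ⟨h4, ⟨e, he, hea⟩, ⟨e', he', heb⟩⟩ => ⟨h4, ?_, ?_⟩
  · obtain ⟨e, hmem, rfl⟩ := List.mem_map.1 he
    exact ⟨e, hmem, hea⟩
  · obtain ⟨e, hmem, rfl⟩ := List.mem_map.1 he'
    exact ⟨e, hmem, heb⟩

end BadPairs

section Decomposition

variable {V ι : Type*} {G : SimpleGraph V} {S : ι → Set V}

theorem eq_of_maximal_of_adj (hinj : Function.Injective S)
    (hS : ∀ i, Maximal (IsNonseparable G) (S i)) {u v : V} (huv : G.Adj u v) {i j : ι}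
    (hui : u ∈ S i) (hvi : v ∈ S i) (huj : u ∈ S j) (hvj : v ∈ S j) : i = j :=
  hinj (eq_of_maximal_isNonseparable (hS i) (hS j) ⟨u, ⟨hui, huj⟩, v, ⟨hvi, hvj⟩, huv.ne⟩)

variable [Finite V] [Fintype ι]

theorem edgeSet_ncard_eq_sum_of_le (hinj : Function.Injective S)
    (hS : ∀ T, Maximal (IsNonseparable G) T ↔ ∃ i, S i = T) {F : SimpleGraph V} (hle : F ≤ G) :
    F.edgeSet.ncard = ∑ i, (F.induce (S i)).edgeSet.ncard := by
  refine edgeSet_ncard_eq_sum F S (fun u v huv => ?_) fun u v huv i j =>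
    eq_of_maximal_of_adj hinj (fun i => (hS _).2 ⟨i, rfl⟩) (hle huv)
  obtain ⟨T, hle', hT⟩ := (isNonseparable_pair (hle huv)).exists_maximal
  obtain ⟨i, rfl⟩ := (hS T).1 hT
  exact ⟨i, hle' (by simp), hle' (by simp)⟩

theorem cyc_eq_sum_and_nonneg (hinj : Function.Injective S)
    (hS : ∀ T, Maximal (IsNonseparable G) T ↔ ∃ i, S i = T) :
    cyc G = ∑ i, cyc (G.induce (S i)) ∧ ∀ i, 0 ≤ cyc (G.induce (S i)) := by
  obtain ⟨F, hle, hF, hr⟩ := G.exists_isAcyclic_reachable_eq_le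
  have hi : ∀ i, cyc (G.induce (S i)) =
      ((G.induce (S i)).edgeSet.ncard : ℤ) - (F.induce (S i)).edgeSet.ncard := fun i =>
    cyc_eq_sub_of_spanningForest (hF.induce _)
      (reachable_induce_eq_of_maximal hle hr ((hS _).2 ⟨i, rfl⟩))
  refine ⟨?_, fun i => ?_⟩
  · rw [cyc_eq_sub_of_spanningForest hF hr, edgeSet_ncard_eq_sum_of_le hinj hS le_rfl,
      edgeSet_ncard_eq_sum_of_le hinj hS hle]
    simp only [hi, Finset.sum_sub_distrib, Nat.cast_sum]
  · rw [hi, sub_nonneg, Nat.cast_le]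
    exact Set.ncard_le_ncard (SimpleGraph.edgeSet_mono fun _ _ h => hle h)

theorem n1_eq_sum (elt : Sym2 V → Sym2 V → Prop) (hinj : Function.Injective S)
    (hS : ∀ T, Maximal (IsNonseparable G) T ↔ ∃ i, S i = T) :
    n1 G elt = ∑ i, n1 (G.induce (S i)) (restrictOrd elt (S i)) := by
  have hfin : ∀ i, Finite (G.induce (S i)).Dart := fun i =>
    Finite.of_injective _ SimpleGraph.Dart.toProd_injective
  refine ncard_eq_sum_ncard _
    (fun i => {z | ∃ a b, BadPair (G.induce (S i)) (restrictOrd elt (S i)) a b ∧ z = s(a, b)})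
    (fun i => Sym2.map (inducedDart G (S i)))
    (fun i => Sym2.map.injective (inducedDart_injective _)) ?_ ?_ ?_
  · rintro i _ ⟨a, b, h, rfl⟩
    exact ⟨_, _, h.inducedDart, rfl⟩
  · rintro _ ⟨a, b, h, rfl⟩
    obtain ⟨T, hT, a', b', h', rfl, rfl⟩ := h.exists_maximal_isNonseparable
    obtain ⟨i, rfl⟩ := (hS T).1 hT
    exact ⟨i, s(a', b'), ⟨a', b', h', rfl⟩, rfl⟩
  · rintro i j _ ⟨a, b, -, rfl⟩ _ ⟨c, d, -, rfl⟩ h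
    have key : ∀ e : (G.induce (S j)).Dart, inducedDart G (S i) a = inducedDart G (S j) e →
        i = j := by
      intro e he
      have h1 : a.fst.1 = e.fst.1 := congrArg (fun d : G.Dart => d.fst) he
      have h2 : a.snd.1 = e.snd.1 := congrArg (fun d : G.Dart => d.snd) he
      exact eq_of_maximal_of_adj hinj (fun i => (hS _).2 ⟨i, rfl⟩) (inducedDart G (S i) a).adj
        a.fst.2 a.snd.2 (h1 ▸ e.fst.2 : a.fst.1 ∈ S j) (h2 ▸ e.snd.2 : a.snd.1 ∈ S j)
    rw [Sym2.map_mk, Sym2.map_mk, Sym2.eq_iff] at h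
    rcases h with ⟨h, -⟩ | ⟨h, -⟩
    · exact key c h
    · exact key d h

end Decomposition

theorem sum_sq_eq_sum_add_two_mul_sum_lt {ι R : Type*} [Fintype ι] [LinearOrder ι] [CommRing R]
    (c : ι → R) :
    (∑ i, c i) ^ 2 = ∑ i, c i ^ 2 + 2 * ∑ i, ∑ j, if i < j then c i * c j else 0 := by
  have hsplit : ∀ i j, c i * c j = (if i = j then c i * c j else 0) +
      (if i < j then c i * c j else 0) + (if j < i then c j * c i else 0) := by
    intro i j
    rcases lt_trichotomy i j with h | rfl | h
    · simp [h, h.ne, h.not_gt]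
    · simp
    · simp [h, h.ne', h.not_gt, mul_comm]
  rw [sq, Finset.sum_mul_sum, Finset.sum_congr rfl fun i _ => Finset.sum_congr rfl
    fun j _ => hsplit i j]
  simp only [Finset.sum_add_distrib, Finset.sum_ite_eq, Finset.mem_univ, if_true]
  rw [Finset.sum_comm (f := fun i j => if j < i then c j * c i else 0)]
  simp only [sq]
  ring

theorem coe_eq_induce_verts {V : Type*} {G : SimpleGraph V} {H : G.Subgraph}
    (h : H = (⊤ : G.Subgraph).induce H.verts) : H.coe = G.induce H.verts := by
  ext a b
  have hadj : H.Adj a b ↔ ((⊤ : G.Subgraph).induce H.verts).Adj a b := by rw [← h]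
  simpa using hadj

open Filter in
theorem stmt2 {V : Type*} [Fintype V] (G : SimpleGraph V)
    (elt : Sym2 V → Sym2 V → Prop) (hord : IsStrictTotalOrder (Sym2 V) elt)
    (k : ℕ) (B : Fin k → G.Subgraph) (hBinj : Function.Injective B)
    (hBall : ∀ H : G.Subgraph, IsBlock G H ↔ ∃ i, B i = H) :
    cyc G = ∑ i, cyc (B i).coe ∧
      n1 G elt = ∑ i, n1 (B i).coe (restrictOrd elt (B i).verts) ∧
      gammaTwo G elt =
        (∑ i, gammaTwo (B i).coe (restrictOrd elt (B i).verts)) +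
          4 * ∑ i, ∑ j, (if i < j then cyc (B i).coe * cyc (B j).coe else 0) ∧
      (∑ i, gammaTwo (B i).coe (restrictOrd elt (B i).verts)) ≤ gammaTwo G elt := by
  have hB : ∀ i, Maximal (IsNonseparable G) (B i).verts ∧
      B i = (⊤ : G.Subgraph).induce (B i).verts :=
    fun i => isBlock_iff.1 ((hBall _).2 ⟨i, rfl⟩)
  have hinj : Function.Injective fun i => (B i).verts := fun i j h => by
    have h' : (B i).verts = (B j).verts := h
    exact hBinj (by rw [(hB i).2, (hB j).2, h'])
  have hS : ∀ T, Maximal (IsNonseparable G) T ↔ ∃ i, (B i).verts = T := by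
    refine fun T => ⟨fun hT => ?_, ?_⟩
    · obtain ⟨i, hi⟩ := (hBall ((⊤ : G.Subgraph).induce T)).1 (isBlock_iff.2 ⟨hT, rfl⟩)
      exact ⟨i, by rw [hi]; rfl⟩
    · rintro ⟨i, rfl⟩
      exact (hB i).1
  have hcoe : ∀ i, (B i).coe = G.induce (B i).verts := fun i => coe_eq_induce_verts (hB i).2
  obtain ⟨hc, hnn⟩ := cyc_eq_sum_and_nonneg hinj hS
  have hn := n1_eq_sum elt hinj hS
  simp only [gammaTwo, hcoe]
  have hγ : 2 * cyc G * (cyc G + 2) - (n1 G elt : ℤ) =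
      (∑ i, (2 * cyc (G.induce (B i).verts) * (cyc (G.induce (B i).verts) + 2) -
        (n1 (G.induce (B i).verts) (restrictOrd elt (B i).verts) : ℤ))) +
      4 * ∑ i, ∑ j, (if i < j then
        cyc (G.induce (B i).verts) * cyc (G.induce (B j).verts) else 0) := by
    have hsq := sum_sq_eq_sum_add_two_mul_sum_lt fun i => cyc (G.induce (B i).verts)
    have hterm : ∀ x : ℤ, 2 * x * (x + 2) = 2 * x ^ 2 + 4 * x := fun x => by ring
    simp only [hterm, Finset.sum_sub_distrib, Finset.sum_add_distrib, ← Finset.mul_sum]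
    rw [hc, hn, hsq]
    push_cast
    ring
  refine ⟨hc, hn, hγ, ?_⟩
  rw [hγ]
  refine le_add_of_nonneg_right (mul_nonneg (by norm_num) (Finset.sum_nonneg fun i _ =>
    Finset.sum_nonneg fun j _ => ?_))
  split_ifs
  · exact mul_nonneg (hnn i) (hnn j)
  · exact le_rfl

end SEP
end

section
/- Let G = ([n],E) be a 2-connected graph, let e = ij ∈ E be an edge with deg_G(i) = 2, and let f = ik be the unique other edge of G incident to i. Let < be a total order on E in which e is the largest element and f is the second largest, and let <' be its restriction to E∖{e}. Then γ₂(G,<) ≥ γ₂(G∖e,<'), and equality holds if and only if every edge of G lies in a 3-cycle or a 4-cycle of G together with e. -/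
open SimpleGraph Finset Filter

namespace SEP

section Arcs

variable {V : Type*} {G : SimpleGraph V}

theorem exists_cycle_three_iff (P : List (V × V) → Prop) :
    (∃ (u : V) (w : G.Walk u u), w.IsCycle ∧ w.length = 3 ∧ P (w.darts.map Dart.toProd)) ↔
      ∃ x y z, G.Adj x y ∧ G.Adj y z ∧ G.Adj z x ∧ P [(x, y), (y, z), (z, x)] := by
  constructor
  · rintro ⟨u, w, -, hl, hP⟩
    match w, hl, hP with
    | .cons h₁ (.cons h₂ (.cons h₃ .nil)), _, hP => exact ⟨_, _, _, h₁, h₂, h₃, hP⟩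
  · rintro ⟨x, y, z, h₁, h₂, h₃, hP⟩
    refine ⟨x, .cons h₁ (.cons h₂ (.cons h₃ .nil)), ?_, rfl, hP⟩
    simp [Walk.cons_isCycle_iff, h₁.ne, h₂.ne, h₃.ne, h₁.ne', h₃.ne']

theorem exists_cycle_four_iff (P : List (V × V) → Prop) :
    (∃ (u : V) (w : G.Walk u u), w.IsCycle ∧ w.length = 4 ∧ P (w.darts.map Dart.toProd)) ↔
      ∃ x y z t, G.Adj x y ∧ G.Adj y z ∧ G.Adj z t ∧ G.Adj t x ∧ x ≠ z ∧ y ≠ t ∧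
        P [(x, y), (y, z), (z, t), (t, x)] := by
  constructor
  · rintro ⟨u, w, hc, hl, hP⟩
    match w, hc, hl, hP with
    | .cons h₁ (.cons h₂ (.cons h₃ (.cons h₄ .nil))), hc, _, hP =>
      refine ⟨_, _, _, _, h₁, h₂, h₃, h₄, ?_, ?_, hP⟩ <;>
      · rintro rfl
        simp [Walk.cons_isCycle_iff] at hc
  · rintro ⟨x, y, z, t, h₁, h₂, h₃, h₄, h₅, h₆, hP⟩
    refine ⟨x, .cons h₁ (.cons h₂ (.cons h₃ (.cons h₄ .nil))), ?_, rfl, hP⟩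
    simp [Walk.cons_isCycle_iff, h₁.ne, h₂.ne, h₃.ne, h₄.ne, h₁.ne', h₄.ne', h₅, h₆,
      h₅.symm]

theorem mem_darts_iff {u v : V} (w : G.Walk u v) (a : G.Dart) :
    a ∈ w.darts ↔ a.toProd ∈ w.darts.map Dart.toProd :=
  (List.mem_map_of_injective Dart.toProd_injective).symm

theorem edges_eq {u v : V} (w : G.Walk u v) :
    w.edges = (w.darts.map Dart.toProd).map (fun p => s(p.1, p.2)) := by
  simp only [Walk.edges, List.map_map]; rfl

/-- `p` and `q` belong to the list of arcs `l` and neither underlies its minimal edge. -/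
def NonMinimalIn (elt : Sym2 V → Sym2 V → Prop) (p q : V × V) (l : List (V × V)) : Prop :=
  p ∈ l ∧ q ∈ l ∧ (∃ e ∈ l.map (fun r => s(r.1, r.2)), elt e s(p.1, p.2)) ∧
    (∃ e ∈ l.map (fun r => s(r.1, r.2)), elt e s(q.1, q.2))

theorem NonMinimalIn.perm {elt : Sym2 V → Sym2 V → Prop} {p q : V × V} {l l' : List (V × V)}
    (h : NonMinimalIn elt p q l) (hl : l.Perm l') : NonMinimalIn elt p q l' := by
  simpa only [NonMinimalIn, hl.mem_iff, (hl.map _).mem_iff] using h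

/-- `BadPair`, with darts replaced by pairs of vertices and cycles listed by their arcs. -/
def ArcBad (G : SimpleGraph V) (elt : Sym2 V → Sym2 V → Prop) (p q : V × V) : Prop :=
  s(p.1, p.2) ≠ s(q.1, q.2) ∧
    ((∃ x y z, G.Adj x y ∧ G.Adj y z ∧ G.Adj z x ∧
        p ∈ [(x, y), (y, z), (z, x)] ∧ q ∈ [(x, y), (y, z), (z, x)]) ∨
      ∃ x y z t, G.Adj x y ∧ G.Adj y z ∧ G.Adj z t ∧ G.Adj t x ∧ x ≠ z ∧ y ≠ t ∧
        NonMinimalIn elt p q [(x, y), (y, z), (z, t), (t, x)])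

theorem badPair_iff (elt : Sym2 V → Sym2 V → Prop) (a b : G.Dart) :
    BadPair G elt a b ↔ ArcBad G elt a.toProd b.toProd := by
  unfold BadPair ArcBad dartsInCycle
  simp only [mem_darts_iff, edges_eq]
  rw [← exists_cycle_three_iff (fun l => a.toProd ∈ l ∧ b.toProd ∈ l),
    ← exists_cycle_four_iff (NonMinimalIn elt a.toProd b.toProd)]
  rfl

theorem ArcBad.adj {elt : Sym2 V → Sym2 V → Prop} {p q : V × V} (h : ArcBad G elt p q) :
    G.Adj p.1 p.2 ∧ G.Adj q.1 q.2 := by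
  rcases h with ⟨-, ⟨x, y, z, h₁, h₂, h₃, hp, hq⟩ | ⟨x, y, z, t, h₁, h₂, h₃, h₄, -, -, hp, hq, -⟩⟩ <;>
    simp only [List.mem_cons, List.not_mem_nil, or_false] at hp hq <;>
    constructor <;> grind

theorem n1_eq (elt : Sym2 V → Sym2 V → Prop) :
    n1 G elt = Set.ncard {z : Sym2 (V × V) | ∃ p q, ArcBad G elt p q ∧ z = s(p, q)} := by
  unfold n1
  rw [← Set.ncard_image_of_injective _ (Sym2.map.injective Dart.toProd_injective)]
  congr 1
  ext z
  constructor
  · rintro ⟨_, ⟨a, b, h, rfl⟩, rfl⟩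
    exact ⟨_, _, (badPair_iff elt a b).1 h, rfl⟩
  · rintro ⟨p, q, h, rfl⟩
    exact ⟨_, ⟨⟨p, h.adj.1⟩, ⟨q, h.adj.2⟩, (badPair_iff elt _ _).2 h, rfl⟩, rfl⟩

theorem exists_triangle_iff {i j k : V} (hij : G.Adj i j) (hik : G.Adj i k)
    (hdeg : ∀ l, G.Adj i l → l = j ∨ l = k) (P : List (V × V) → Prop)
    (hP : ∀ x y z, P [(x, y), (y, z), (z, x)] → P [(y, z), (z, x), (x, y)]) :
    (∃ x y z, G.Adj x y ∧ G.Adj y z ∧ G.Adj z x ∧ P [(x, y), (y, z), (z, x)]) ↔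
      (∃ x y z, (G.deleteEdges {s(i, j)}).Adj x y ∧ (G.deleteEdges {s(i, j)}).Adj y z ∧
        (G.deleteEdges {s(i, j)}).Adj z x ∧ P [(x, y), (y, z), (z, x)]) ∨
      (G.Adj j k ∧ (P [(i, j), (j, k), (k, i)] ∨ P [(i, k), (k, j), (j, i)])) := by
  have start : ∀ y z, G.Adj i y → G.Adj y z → G.Adj z i → P [(i, y), (y, z), (z, i)] →
      G.Adj j k ∧ (P [(i, j), (j, k), (k, i)] ∨ P [(i, k), (k, j), (j, i)]) := by
    intro y z h₁ h₂ h₃ h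
    have := h₂.ne
    rcases hdeg y h₁ with rfl | rfl <;> rcases hdeg z h₃.symm with rfl | rfl
    · exact absurd rfl this
    · exact ⟨h₂, .inl h⟩
    · exact ⟨h₂.symm, .inr h⟩
    · exact absurd rfl this
  constructor
  · rintro ⟨x, y, z, h₁, h₂, h₃, h⟩
    by_cases hx : x = i
    · subst hx; exact .inr (start _ _ h₁ h₂ h₃ h)
    by_cases hy : y = i
    · subst hy; exact .inr (start _ _ h₂ h₃ h₁ (hP _ _ _ h))
    by_cases hz : z = i
    · subst hz; exact .inr (start _ _ h₃ h₁ h₂ (hP _ _ _ (hP _ _ _ h)))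
    refine .inl ⟨x, y, z, ?_, ?_, ?_, h⟩ <;> simp [deleteEdges_adj, *]
  · rintro (⟨x, y, z, h₁, h₂, h₃, h⟩ | ⟨h₁, h | h⟩)
    · exact ⟨x, y, z, h₁.1, h₂.1, h₃.1, h⟩
    · exact ⟨i, j, k, hij, h₁, hik.symm, h⟩
    · exact ⟨i, k, j, hik, h₁.symm, hij.symm, h⟩

theorem exists_square_iff {i j k : V} (hij : G.Adj i j) (hik : G.Adj i k) (hjk : j ≠ k)
    (hdeg : ∀ l, G.Adj i l → l = j ∨ l = k) (P : List (V × V) → Prop)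
    (hP : ∀ x y z t, P [(x, y), (y, z), (z, t), (t, x)] →
      P [(y, z), (z, t), (t, x), (x, y)]) :
    (∃ x y z t, G.Adj x y ∧ G.Adj y z ∧ G.Adj z t ∧ G.Adj t x ∧ x ≠ z ∧ y ≠ t ∧
        P [(x, y), (y, z), (z, t), (t, x)]) ↔
      (∃ x y z t, (G.deleteEdges {s(i, j)}).Adj x y ∧ (G.deleteEdges {s(i, j)}).Adj y z ∧
        (G.deleteEdges {s(i, j)}).Adj z t ∧ (G.deleteEdges {s(i, j)}).Adj t x ∧ x ≠ z ∧ y ≠ t ∧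
        P [(x, y), (y, z), (z, t), (t, x)]) ∨
      ∃ l, l ≠ i ∧ G.Adj j l ∧ G.Adj l k ∧
        (P [(i, j), (j, l), (l, k), (k, i)] ∨ P [(i, k), (k, l), (l, j), (j, i)]) := by
  have start : ∀ y z t, G.Adj i y → G.Adj y z → G.Adj z t → G.Adj t i → i ≠ z → y ≠ t →
      P [(i, y), (y, z), (z, t), (t, i)] → ∃ l, l ≠ i ∧ G.Adj j l ∧ G.Adj l k ∧
        (P [(i, j), (j, l), (l, k), (k, i)] ∨ P [(i, k), (k, l), (l, j), (j, i)]) := by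
    intro y z t h₁ h₂ h₃ h₄ h₅ h₆ h
    rcases hdeg y h₁ with rfl | rfl <;> rcases hdeg t h₄.symm with rfl | rfl
    · exact absurd rfl h₆
    · exact ⟨z, h₅.symm, h₂, h₃, .inl h⟩
    · exact ⟨z, h₅.symm, h₃.symm, h₂.symm, .inr h⟩
    · exact absurd rfl h₆
  constructor
  · rintro ⟨x, y, z, t, h₁, h₂, h₃, h₄, h₅, h₆, h⟩
    by_cases hx : x = i
    · subst hx; exact .inr (start _ _ _ h₁ h₂ h₃ h₄ h₅ h₆ h)
    by_cases hy : y = i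
    · subst hy; exact .inr (start _ _ _ h₂ h₃ h₄ h₁ h₆ h₅.symm (hP _ _ _ _ h))
    by_cases hz : z = i
    · subst hz
      exact .inr (start _ _ _ h₃ h₄ h₁ h₂ h₅.symm h₆.symm (hP _ _ _ _ (hP _ _ _ _ h)))
    by_cases ht : t = i
    · subst ht
      exact .inr (start _ _ _ h₄ h₁ h₂ h₃ h₆.symm h₅
        (hP _ _ _ _ (hP _ _ _ _ (hP _ _ _ _ h))))
    refine .inl ⟨x, y, z, t, ?_, ?_, ?_, ?_, h₅, h₆, h⟩ <;> simp [deleteEdges_adj, *]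
  · rintro (⟨x, y, z, t, h₁, h₂, h₃, h₄, h₅, h₆, h⟩ | ⟨l, hl, h₁, h₂, h | h⟩)
    · exact ⟨x, y, z, t, h₁.1, h₂.1, h₃.1, h₄.1, h₅, h₆, h⟩
    · exact ⟨i, j, l, k, hij, h₁, h₂, hik.symm, hl.symm, hjk, h⟩
    · exact ⟨i, k, l, j, hik, h₂.symm, h₁.symm, hij.symm, hl.symm, hjk.symm, h⟩

/-- `v` completes the path `j i k` to a triangle (when `v = k`) or to a square. -/
def Closes (G : SimpleGraph V) (i j k v : V) : Prop :=
  v ≠ i ∧ G.Adj j v ∧ (v = k ∨ G.Adj v k)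

open Classical in
/-- The arc opposite to `i`, and not below the other one, of the cycle closed by `v`. -/
noncomputable def farArc (elt : Sym2 V → Sym2 V → Prop) (j k v : V) : V × V :=
  if v = k then (j, k) else if elt s(j, v) s(v, k) then (v, k) else (j, v)

/-- `p` involves an arc at `i` and `q` is the other arc at `i` or lies on the opposite arc `a`,
for one of the two orientations. -/
def NewBad (i j k : V) (a p q : V × V) : Prop :=
  (p = (i, j) ∧ q = (k, i)) ∨ (p = (j, i) ∧ q = (i, k)) ∨
    ((p = (i, j) ∨ p = (k, i)) ∧ q = a) ∨ ((p = (j, i) ∨ p = (i, k)) ∧ q = a.swap)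

theorem newBad_or_newBad_iff {i j k : V} {a p q : V × V} :
    NewBad i j k a p q ∨ NewBad i j k a q p ↔
      s(p, q) = s((i, j), (k, i)) ∨ s(p, q) = s((j, i), (i, k)) ∨
        s(p, q) = s((i, j), a) ∨ s(p, q) = s((k, i), a) ∨
        s(p, q) = s((j, i), a.swap) ∨ s(p, q) = s((i, k), a.swap) := by
  simp only [Sym2.eq_iff]
  constructor
  · rintro ((⟨rfl, rfl⟩ | ⟨rfl, rfl⟩ | ⟨rfl | rfl, rfl⟩ | ⟨rfl | rfl, rfl⟩) |
      (⟨rfl, rfl⟩ | ⟨rfl, rfl⟩ | ⟨rfl | rfl, rfl⟩ | ⟨rfl | rfl, rfl⟩)) <;> simp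
  · rintro ((⟨rfl, rfl⟩ | ⟨rfl, rfl⟩) | (⟨rfl, rfl⟩ | ⟨rfl, rfl⟩) | (⟨rfl, rfl⟩ | ⟨rfl, rfl⟩) |
      (⟨rfl, rfl⟩ | ⟨rfl, rfl⟩) | (⟨rfl, rfl⟩ | ⟨rfl, rfl⟩) | (⟨rfl, rfl⟩ | ⟨rfl, rfl⟩)) <;>
    simp [NewBad]

theorem farArc_avoids (elt : Sym2 V → Sym2 V → Prop) {i j k v : V}
    (hj : j ≠ i) (hk : k ≠ i) (hv : v ≠ i) :
    (farArc elt j k v).1 ≠ i ∧ (farArc elt j k v).2 ≠ i := by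
  unfold farArc
  split_ifs <;> simp [*]

theorem arcBad_iff {i j k : V} (hij : G.Adj i j) (hik : G.Adj i k) (hjk : j ≠ k)
    (hdeg : ∀ l, G.Adj i l → l = j ∨ l = k) (elt : Sym2 V → Sym2 V → Prop)
    (hord : IsStrictTotalOrder (Sym2 V) elt)
    (hmax : ∀ e' ∈ G.edgeSet, e' ≠ s(i, j) → elt e' s(i, j))
    (hsecond : ∀ e' ∈ G.edgeSet, e' ≠ s(i, j) → e' ≠ s(i, k) → elt e' s(i, k))
    (p q : V × V) :
    ArcBad G elt p q ↔ ArcBad (G.deleteEdges {s(i, j)}) elt p q ∨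
      ∃ v, Closes G i j k v ∧
        (NewBad i j k (farArc elt j k v) p q ∨ NewBad i j k (farArc elt j k v) q p) := by
  have hji := hij.ne'
  have hki := hik.ne'
  unfold ArcBad
  rw [exists_triangle_iff hij hik hdeg (fun l => p ∈ l ∧ q ∈ l) (by
      intro x y z; simp only [List.mem_cons, List.not_mem_nil, or_false]; tauto),
    exists_square_iff hij hik hjk hdeg (NonMinimalIn elt p q) fun x y z t h =>
      h.perm (List.perm_append_singleton (x, y) [(y, z), (z, t), (t, x)]).symm]
  have tri : (s(p.1, p.2) ≠ s(q.1, q.2) ∧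
      ((p ∈ [(i, j), (j, k), (k, i)] ∧ q ∈ [(i, j), (j, k), (k, i)]) ∨
        (p ∈ [(i, k), (k, j), (j, i)] ∧ q ∈ [(i, k), (k, j), (j, i)]))) ↔
      (NewBad i j k (j, k) p q ∨ NewBad i j k (j, k) q p) := by
    simp only [List.mem_cons, List.not_mem_nil, or_false, NewBad, Prod.swap_prod_mk]
    constructor
    · rintro ⟨hne, ⟨rfl | rfl | rfl, rfl | rfl | rfl⟩ | ⟨rfl | rfl | rfl, rfl | rfl | rfl⟩⟩ <;>
        simp at hne ⊢
    · rintro ((⟨rfl, rfl⟩ | ⟨rfl, rfl⟩ | ⟨rfl | rfl, rfl⟩ | ⟨rfl | rfl, rfl⟩) |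
        (⟨rfl, rfl⟩ | ⟨rfl, rfl⟩ | ⟨rfl | rfl, rfl⟩ | ⟨rfl | rfl, rfl⟩)) <;>
      simp [hji, hki, hjk, hji.symm, hki.symm, hjk.symm]
  have sq : ∀ l, l ≠ i → G.Adj j l → G.Adj l k → ((s(p.1, p.2) ≠ s(q.1, q.2) ∧
      (NonMinimalIn elt p q [(i, j), (j, l), (l, k), (k, i)] ∨
        NonMinimalIn elt p q [(i, k), (k, l), (l, j), (j, i)])) ↔
      (NewBad i j k (farArc elt j k l) p q ∨ NewBad i j k (farArc elt j k l) q p)) := by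
    intro l hl h₁ h₂
    have irr := hord.irrefl
    have asym : ∀ a b, elt a b → ¬ elt b a := fun a b => asymm_of elt
    have hlj := h₁.ne'
    have hlk := h₂.ne
    have e₁ : elt s(j, l) s(i, j) := hmax _ h₁ (by simp [*])
    have e₂ : elt s(l, k) s(i, j) := hmax _ h₂ (by simp [*])
    have e₃ : elt s(j, l) s(i, k) := hsecond _ h₁ (by simp [*]) (by simp [*])
    have e₄ : elt s(l, k) s(i, k) := hsecond _ h₂ (by simp [*]) (by simp [*])
    have e₅ := asym _ _ e₁
    have e₆ := asym _ _ e₂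
    have e₇ := asym _ _ e₃
    have e₈ := asym _ _ e₄
    have t : elt s(j, l) s(l, k) ∨ elt s(l, k) s(j, l) := by
      rcases trichotomous_of elt s(j, l) s(l, k) with h | h | h
      · exact .inl h
      · simp [hjk, hlj.symm] at h
      · exact .inr h
    have fwd : ∀ r ∈ [(i, j), (j, l), (l, k), (k, i)],
        ((∃ e ∈ [s(i, j), s(j, l), s(l, k), s(k, i)], elt e s(r.1, r.2)) ↔
          r = (i, j) ∨ r = (k, i) ∨ r = farArc elt j k l) := by
      simp only [List.mem_cons, List.not_mem_nil, or_false, exists_eq_or_imp, exists_eq_left,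
        farArc, hlk, if_false]
      have := Sym2.eq_swap (a := k) (b := i)
      rcases t with t | t <;> have t' := asym _ _ t <;>
        rintro _ (rfl | rfl | rfl | rfl) <;> simp [*]
    have bwd : ∀ r ∈ [(i, k), (k, l), (l, j), (j, i)],
        ((∃ e ∈ [s(i, k), s(k, l), s(l, j), s(j, i)], elt e s(r.1, r.2)) ↔
          r = (j, i) ∨ r = (i, k) ∨ r = (farArc elt j k l).swap) := by
      simp only [List.mem_cons, List.not_mem_nil, or_false, exists_eq_or_imp, exists_eq_left,
        farArc, hlk, if_false]
      have := Sym2.eq_swap (a := j) (b := i)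
      have := Sym2.eq_swap (a := k) (b := l)
      have := Sym2.eq_swap (a := l) (b := j)
      rcases t with t | t <;> have t' := asym _ _ t <;>
        rintro _ (rfl | rfl | rfl | rfl) <;> simp [*]
    have far : farArc elt j k l = (j, l) ∨ farArc elt j k l = (l, k) := by
      unfold farArc; split_ifs <;> simp_all
    unfold NonMinimalIn
    simp only [List.map_cons, List.map_nil]
    generalize farArc elt j k l = a at *
    constructor
    · rintro ⟨hne, ⟨hp, hq, hp', hq'⟩ | ⟨hp, hq, hp', hq'⟩⟩
      · rw [fwd p hp] at hp'
        rw [fwd q hq] at hq'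
        have : p ≠ q := fun h => hne (by rw [h])
        unfold NewBad
        grind
      · rw [bwd p hp] at hp'
        rw [bwd q hq] at hq'
        have : p ≠ q := fun h => hne (by rw [h])
        unfold NewBad
        grind
    · intro h
      have key : s(p.1, p.2) ≠ s(q.1, q.2) ∧
          (((p ∈ [(i, j), (j, l), (l, k), (k, i)] ∧ q ∈ [(i, j), (j, l), (l, k), (k, i)]) ∧
            (p = (i, j) ∨ p = (k, i) ∨ p = a) ∧ (q = (i, j) ∨ q = (k, i) ∨ q = a)) ∨
          ((p ∈ [(i, k), (k, l), (l, j), (j, i)] ∧ q ∈ [(i, k), (k, l), (l, j), (j, i)]) ∧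
            (p = (j, i) ∨ p = (i, k) ∨ p = a.swap) ∧
              (q = (j, i) ∨ q = (i, k) ∨ q = a.swap))) := by
        simp only [List.mem_cons, List.not_mem_nil, or_false]
        rcases far with rfl | rfl <;>
        rcases h with (⟨rfl, rfl⟩ | ⟨rfl, rfl⟩ | ⟨rfl | rfl, rfl⟩ | ⟨rfl | rfl, rfl⟩) |
          (⟨rfl, rfl⟩ | ⟨rfl, rfl⟩ | ⟨rfl | rfl, rfl⟩ | ⟨rfl | rfl, rfl⟩) <;>
        simp [hji, hki, hjk, hl, hji.symm, hki.symm, hjk.symm, hl.symm]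
      obtain ⟨hne, ⟨⟨hp, hq⟩, hp', hq'⟩ | ⟨⟨hp, hq⟩, hp', hq'⟩⟩ := key
      · exact ⟨hne, .inl ⟨hp, hq, (fwd p hp).2 hp', (fwd q hq).2 hq'⟩⟩
      · exact ⟨hne, .inr ⟨hp, hq, (bwd p hp).2 hp', (bwd q hq).2 hq'⟩⟩
  constructor
  · rintro ⟨hne, (h | ⟨h, h'⟩) | (h | ⟨l, hl, h₁, h₂, h⟩)⟩
    · exact .inl ⟨hne, .inl h⟩
    · exact .inr ⟨k, ⟨hki, h, .inl rfl⟩, by simpa [farArc] using tri.1 ⟨hne, h'⟩⟩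
    · exact .inl ⟨hne, .inr h⟩
    · exact .inr ⟨l, ⟨hl, h₁, .inr h₂⟩, (sq l hl h₁ h₂).1 ⟨hne, h⟩⟩
  · rintro (⟨hne, h | h⟩ | ⟨l, ⟨hl, h₁, h₂⟩, h⟩)
    · exact ⟨hne, .inl (.inl h)⟩
    · exact ⟨hne, .inr (.inl h)⟩
    · by_cases hlk : l = k
      · subst hlk
        obtain ⟨hne, h'⟩ := tri.2 (by simpa [farArc] using h)
        exact ⟨hne, .inl (.inr ⟨h₁, h'⟩)⟩
      · obtain ⟨hne, h'⟩ := (sq l hl h₁ (h₂.resolve_left hlk)).2 h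
        exact ⟨hne, .inr (.inr ⟨l, hl, h₁, h₂.resolve_left hlk, h'⟩)⟩

/-- `e'` lies in a cycle of length 3 or 4 through `j i k`. -/
def InShort (G : SimpleGraph V) (i j k : V) (e' : Sym2 V) : Prop :=
  ∃ l, Closes G i j k l ∧ (e' = s(i, j) ∨ e' = s(i, k) ∨ e' = s(j, l) ∨ (l ≠ k ∧ e' = s(l, k)))

theorem exists_short_cycle_iff {i j k : V} (hij : G.Adj i j) (hik : G.Adj i k) (hjk : j ≠ k)
    (hdeg : ∀ l, G.Adj i l → l = j ∨ l = k) (e' : Sym2 V) :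
    (∃ (u : V) (w : G.Walk u u),
      w.IsCycle ∧ (w.length = 3 ∨ w.length = 4) ∧ e' ∈ w.edges ∧ s(i, j) ∈ w.edges) ↔
    InShort G i j k e' := by
  let P : List (V × V) → Prop := fun l =>
    e' ∈ l.map (fun p => s(p.1, p.2)) ∧ s(i, j) ∈ l.map (fun p => s(p.1, p.2))
  have hP : ∀ {l l' : List (V × V)}, l.Perm l' → P l → P l' := by
    intro l l' h
    simp only [P, (h.map _).mem_iff, imp_self]
  have split : (∃ (u : V) (w : G.Walk u u),
      w.IsCycle ∧ (w.length = 3 ∨ w.length = 4) ∧ e' ∈ w.edges ∧ s(i, j) ∈ w.edges) ↔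
      (∃ (u : V) (w : G.Walk u u), w.IsCycle ∧ w.length = 3 ∧ P (w.darts.map Dart.toProd)) ∨
      (∃ (u : V) (w : G.Walk u u), w.IsCycle ∧ w.length = 4 ∧ P (w.darts.map Dart.toProd)) := by
    simp only [P, ← edges_eq]
    grind
  have notin : ∀ {x y}, (G.deleteEdges {s(i, j)}).Adj x y → s(i, j) ≠ s(x, y) := by
    intro x y h
    rw [deleteEdges_adj] at h
    exact fun h' => h.2 h'.symm
  rw [split, exists_cycle_three_iff, exists_cycle_four_iff,
    exists_triangle_iff hij hik hdeg P
      fun x y z h => hP (List.perm_append_singleton (x, y) [(y, z), (z, x)]).symm h,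
    exists_square_iff hij hik hjk hdeg P
      fun x y z t h => hP (List.perm_append_singleton (x, y) [(y, z), (z, t), (t, x)]).symm h]
  simp only [P, List.map_cons, List.map_nil, List.mem_cons, List.not_mem_nil, or_false]
  have hki := hik.ne'
  constructor
  · rintro ((⟨x, y, z, h₁, h₂, h₃, -, h⟩ | ⟨h₁, h⟩) |
      (⟨x, y, z, t, h₁, h₂, h₃, h₄, -, -, -, h⟩ | ⟨l, hl, h₁, h₂, h⟩))
    · simp [notin h₁, notin h₂, notin h₃] at h
    · refine ⟨k, ⟨hki, h₁, .inl rfl⟩, ?_⟩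
      have := Sym2.eq_swap (a := k) (b := i)
      have := Sym2.eq_swap (a := j) (b := i)
      have := Sym2.eq_swap (a := k) (b := j)
      grind
    · simp [notin h₁, notin h₂, notin h₃, notin h₄] at h
    · refine ⟨l, ⟨hl, h₁, .inr h₂⟩, ?_⟩
      have := h₂.ne
      have := Sym2.eq_swap (a := k) (b := i)
      have := Sym2.eq_swap (a := j) (b := i)
      have := Sym2.eq_swap (a := k) (b := l)
      have := Sym2.eq_swap (a := l) (b := j)
      grind
  · rintro ⟨l, ⟨hl, h₁, h₂⟩, h⟩
    have := Sym2.eq_swap (a := k) (b := i)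
    by_cases hlk : l = k
    · subst hlk
      exact .inl (.inr ⟨h₁, .inl (by grind)⟩)
    · exact .inr (.inr ⟨l, hl, h₁, h₂.resolve_left hlk, .inl (by grind)⟩)

open Classical in
/-- The set of `v` closing the path `j i k`. -/
noncomputable def closers [Fintype V] (G : SimpleGraph V) (i j k : V) : Finset V :=
  Finset.univ.filter (Closes G i j k)

theorem mem_closers [Fintype V] {i j k v : V} : v ∈ closers G i j k ↔ Closes G i j k v := by
  simp [closers]

theorem ArcBad.avoids {elt : Sym2 V → Sym2 V → Prop} {i k : V} {p q : V × V}
    (h : ArcBad G elt p q) (hi : ∀ l, G.Adj i l → l = k) :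
    (p.1 ≠ i ∧ p.2 ≠ i) ∧ (q.1 ≠ i ∧ q.2 ≠ i) := by
  obtain ⟨-, ⟨x, y, z, h₁, h₂, h₃, hp, hq⟩ |
    ⟨x, y, z, t, h₁, h₂, h₃, h₄, h₅, h₆, hp, hq, -⟩⟩ := h
  · have hx : x ≠ i := by
      rintro rfl; exact h₂.ne ((hi _ h₁).trans (hi _ h₃.symm).symm)
    have hy : y ≠ i := by
      rintro rfl; exact h₃.ne ((hi _ h₂).trans (hi _ h₁.symm).symm)
    have hz : z ≠ i := by
      rintro rfl; exact h₁.ne ((hi _ h₃).trans (hi _ h₂.symm).symm)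
    grind
  · have hx : x ≠ i := by
      rintro rfl; exact h₆ ((hi _ h₁).trans (hi _ h₄.symm).symm)
    have hy : y ≠ i := by
      rintro rfl; exact h₅ ((hi _ h₁.symm).trans (hi _ h₂).symm)
    have hz : z ≠ i := by
      rintro rfl; exact h₆ ((hi _ h₂.symm).trans (hi _ h₃).symm)
    have ht : t ≠ i := by
      rintro rfl; exact h₅ ((hi _ h₄).trans (hi _ h₃.symm).symm)
    grind

open Classical in
theorem n1_eq_add [Fintype V] {i j k : V} (hij : G.Adj i j) (hik : G.Adj i k) (hjk : j ≠ k)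
    (hdeg : ∀ l, G.Adj i l → l = j ∨ l = k) (elt : Sym2 V → Sym2 V → Prop)
    (hord : IsStrictTotalOrder (Sym2 V) elt)
    (hmax : ∀ e' ∈ G.edgeSet, e' ≠ s(i, j) → elt e' s(i, j))
    (hsecond : ∀ e' ∈ G.edgeSet, e' ≠ s(i, j) → e' ≠ s(i, k) → elt e' s(i, k)) :
    n1 G elt = n1 (G.deleteEdges {s(i, j)}) elt +
      (4 * (closers G i j k).card + if (closers G i j k).Nonempty then 2 else 0) := by
  have hji := hij.ne'
  have hki := hik.ne'
  let F : Finset (V × V) := (closers G i j k).image (farArc elt j k)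
  have hF : F.card = (closers G i j k).card := by
    apply Finset.card_image_of_injOn
    intro v hv w hw h
    simp only [Finset.mem_coe, mem_closers] at hv hw
    have := hv.2.1.ne
    have := hw.2.1.ne
    unfold farArc at h
    split_ifs at h <;> simp_all
  have hFi : ∀ a ∈ F, a.1 ≠ i ∧ a.2 ≠ i := by
    intro a ha
    obtain ⟨v, hv, rfl⟩ := Finset.mem_image.1 ha
    exact farArc_avoids elt hji hki (mem_closers.1 hv).1
  let A₀ : Finset (Sym2 (V × V)) :=
    if (closers G i j k).Nonempty then {s((i, j), (k, i)), s((j, i), (i, k))} else ∅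
  let A₁ := F.image fun a => s((i, j), a)
  let A₂ := F.image fun a => s((k, i), a)
  let A₃ := F.image fun a => s((j, i), a.swap)
  let A₄ := F.image fun a => s((i, k), a.swap)
  let D := A₀ ∪ (A₁ ∪ (A₂ ∪ (A₃ ∪ A₄)))
  have c₀ : A₀.card = if (closers G i j k).Nonempty then 2 else 0 := by
    simp only [A₀]
    split_ifs
    · rw [Finset.card_pair]
      simp [hji.symm, hjk]
    · rfl
  have c₁ : A₁.card = F.card :=
    Finset.card_image_of_injective _ fun a b h => Sym2.congr_right.1 h
  have c₂ : A₂.card = F.card :=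
    Finset.card_image_of_injective _ fun a b h => Sym2.congr_right.1 h
  have c₃ : A₃.card = F.card :=
    Finset.card_image_of_injective _ fun a b h => Prod.swap_injective (Sym2.congr_right.1 h)
  have c₄ : A₄.card = F.card :=
    Finset.card_image_of_injective _ fun a b h => Prod.swap_injective (Sym2.congr_right.1 h)
  have hD : D.card = 4 * (closers G i j k).card +
      if (closers G i j k).Nonempty then 2 else 0 := by
    have d₃ : Disjoint A₃ A₄ := by
      rw [Finset.disjoint_left]
      simp only [A₃, A₄, Finset.mem_image, not_exists, not_and]
      rintro _ ⟨a, ha, rfl⟩ b hb h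
      have := hFi a ha
      have := hFi b hb
      simp [Prod.ext_iff] at h
      grind
    have d₂ : Disjoint A₂ (A₃ ∪ A₄) := by
      rw [Finset.disjoint_left]
      simp only [A₂, A₃, A₄, Finset.mem_image, Finset.mem_union]
      rintro _ ⟨a, ha, rfl⟩ (⟨b, hb, h⟩ | ⟨b, hb, h⟩) <;>
      · have := hFi a ha
        have := hFi b hb
        simp [Prod.ext_iff] at h
        grind
    have d₁ : Disjoint A₁ (A₂ ∪ (A₃ ∪ A₄)) := by
      rw [Finset.disjoint_left]
      simp only [A₁, A₂, A₃, A₄, Finset.mem_image, Finset.mem_union]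
      rintro _ ⟨a, ha, rfl⟩ (⟨b, hb, h⟩ | ⟨b, hb, h⟩ | ⟨b, hb, h⟩) <;>
      · have := hFi a ha
        have := hFi b hb
        simp [Prod.ext_iff] at h
        grind
    have d₀ : Disjoint A₀ (A₁ ∪ (A₂ ∪ (A₃ ∪ A₄))) := by
      rw [Finset.disjoint_right]
      have mem : ∀ z ∈ A₀, z = s((i, j), (k, i)) ∨ z = s((j, i), (i, k)) := by
        intro z hz
        simp only [A₀] at hz
        split_ifs at hz
        · simpa using hz
        · simp at hz
      simp only [A₁, A₂, A₃, A₄, Finset.mem_image, Finset.mem_union]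
      rintro _ (⟨b, hb, rfl⟩ | ⟨b, hb, rfl⟩ | ⟨b, hb, rfl⟩ | ⟨b, hb, rfl⟩) hz <;>
      · have := hFi b hb
        have h := mem _ hz
        simp [Prod.ext_iff] at h
        grind
    rw [Finset.card_union_of_disjoint d₀, Finset.card_union_of_disjoint d₁,
      Finset.card_union_of_disjoint d₂, Finset.card_union_of_disjoint d₃, c₀, c₁, c₂, c₃, c₄, hF]
    ring
  have memD : ∀ p q, s(p, q) ∈ D ↔ ∃ v, Closes G i j k v ∧
      (NewBad i j k (farArc elt j k v) p q ∨ NewBad i j k (farArc elt j k v) q p) := by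
    have hA₀ : ∀ z, z ∈ A₀ ↔ ∃ v, Closes G i j k v ∧
        (z = s((i, j), (k, i)) ∨ z = s((j, i), (i, k))) := by
      intro z
      simp only [A₀, Finset.Nonempty, mem_closers, exists_and_right]
      split_ifs with h <;> simp [h]
    intro p q
    simp only [D, Finset.mem_union, hA₀, A₁, A₂, A₃, A₄, F, Finset.mem_image, mem_closers,
      exists_exists_and_eq_and]
    simp only [← exists_or, ← and_or_left]
    refine exists_congr fun v => and_congr_right fun _ => ?_
    rw [newBad_or_newBad_iff]
    simp only [eq_comm (b := s(p, q)), or_assoc]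
  rw [n1_eq, n1_eq, ← hD, ← Set.ncard_coe_finset, ← Set.ncard_union_eq _ (Set.toFinite _)
    (Set.toFinite _)]
  · congr 1
    ext z
    induction z with | _ p q
    have key := arcBad_iff hij hik hjk hdeg elt hord hmax hsecond
    simp only [Set.mem_union, Set.mem_ofPred_eq, Finset.mem_coe, key]
    constructor
    · rintro ⟨p', q', h | h, hz⟩
      · exact .inl ⟨p', q', h, hz⟩
      · rw [hz]; exact .inr ((memD p' q').2 h)
    · rintro (⟨p', q', h, hz⟩ | h)
      · exact ⟨p', q', .inl h, hz⟩
      · exact ⟨p, q, .inr ((memD p q).1 h), rfl⟩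
  · rw [Set.disjoint_left]
    rintro _ ⟨p, q, h, rfl⟩ hz
    obtain ⟨v, -, hv⟩ := (memD p q).1 hz
    have := h.avoids (i := i) (k := k) fun l hl => by
      rw [deleteEdges_adj] at hl
      exact (hdeg l hl.1).resolve_left fun h => hl.2 (by simp [h])
    rcases hv with (⟨rfl, rfl⟩ | ⟨rfl, rfl⟩ | ⟨rfl | rfl, rfl⟩ | ⟨rfl | rfl, rfl⟩) |
      (⟨rfl, rfl⟩ | ⟨rfl, rfl⟩ | ⟨rfl | rfl, rfl⟩ | ⟨rfl | rfl, rfl⟩) <;>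
    simp at this

theorem cyc_eq_of_connected (h : G.Connected) :
    cyc G = (G.edgeSet.ncard : ℤ) + 1 - Nat.card V := by
  have : Nat.card G.ConnectedComponent = 1 := by
    have := h.preconnected.subsingleton_connectedComponent
    have := h.nonempty
    exact Nat.card_eq_one_iff_unique.2 ⟨inferInstance, inferInstance⟩
  simp [cyc, this]

theorem TwoConnected.exists_adj_ne [Finite V] (h : TwoConnected G) (v w : V) (hvw : v ≠ w) :
    ∃ x, G.Adj v x ∧ x ≠ w := by
  obtain ⟨-, h3, hd⟩ := h
  have : Nontrivial {u : V | u ≠ w} := by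
    rw [← Finite.one_lt_card_iff_nontrivial]
    have := Set.ncard_add_ncard_compl {w}
    have e : {u : V | u ≠ w} = {w}ᶜ := rfl
    rw [Set.ncard_singleton] at this
    rw [e, Nat.card_coe_set_eq]
    omega
  obtain ⟨⟨x, hx⟩, hvx⟩ := (hd w).preconnected.exists_adj_of_nontrivial ⟨v, hvw⟩
  exact ⟨x, hvx, hx⟩

theorem TwoConnected.two_le_degree [Fintype V] [DecidableRel G.Adj] (h : TwoConnected G) (v : V) :
    2 ≤ G.degree v := by
  have : Nontrivial V := by
    rw [← Finite.one_lt_card_iff_nontrivial]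
    have := h.2.1
    omega
  obtain ⟨x, hx⟩ := h.1.preconnected.exists_adj_of_nontrivial v
  obtain ⟨y, hy, hyx⟩ := h.exists_adj_ne v x hx.ne
  rw [← G.card_neighborFinset_eq_degree]
  exact Finset.one_lt_card.2 ⟨x, by simpa, y, by simpa, hyx.symm⟩

theorem TwoConnected.connected_deleteEdge (h : TwoConnected G) {i j k : V}
    (hik : G.Adj i k) (hjk : j ≠ k) : (G.deleteEdges {s(i, j)}).Connected := by
  let f : G.induce {u | u ≠ i} →g G.deleteEdges {s(i, j)} :=
    ⟨Subtype.val, by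
      rintro ⟨a, ha⟩ ⟨b, hb⟩ hab
      simp only [Set.mem_ofPred_eq] at ha hb
      simp only [deleteEdges_adj]
      exact ⟨hab, by simp [ha, hb]⟩⟩
  have hk : (G.deleteEdges {s(i, j)}).Adj i k := by
    simp [deleteEdges_adj, hik, hjk.symm, hik.ne']
  rw [connected_iff_exists_forall_reachable]
  refine ⟨k, fun v => ?_⟩
  by_cases hv : v = i
  · subst hv
    exact hk.symm.reachable
  · exact ((h.2.2 i).preconnected ⟨k, hik.ne'⟩ ⟨v, hv⟩).map f

section Counting

variable [Fintype V] {i j k : V}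

open Classical in
/-- The least degree `v` can have in a 2-connected graph with a given set of closers. -/
noncomputable def degreeBound (G : SimpleGraph V) (i j k v : V) : ℕ :=
  if v = j ∨ v = k then (closers G i j k).card + 1 else 2

open Classical in
theorem sum_degreeBound (hjk : j ≠ k) :
    ∑ v, degreeBound G i j k v + 2 = 2 * Fintype.card V + 2 * (closers G i j k).card := by
  have h : ∀ v, degreeBound G i j k v + ((if v = j then 1 else 0) + if v = k then 1 else 0) =
      2 + ((if v = j then (closers G i j k).card else 0) +
        if v = k then (closers G i j k).card else 0) := by
    intro v
    unfold degreeBound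
    grind
  have := Finset.sum_congr (rfl : (Finset.univ : Finset V) = Finset.univ) fun v _ => h v
  simp only [Finset.sum_add_distrib, Finset.sum_ite_eq', Finset.mem_univ, if_true,
    Finset.sum_const, smul_eq_mul, Finset.card_univ] at this
  omega

theorem card_closers_swap_le (hki : k ≠ i) (hji : j ≠ i) :
    (closers G i j k).card ≤ (closers G i k j).card := by
  classical
  refine Finset.card_le_card_of_injOn (fun v => if v = k then j else v) ?_ ?_
  · intro v hv
    simp only [Finset.mem_coe, mem_closers, Closes] at hv ⊢
    have := hv.2.1.symm
    split_ifs with h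
    · subst h
      exact ⟨hji, this, .inl rfl⟩
    · exact ⟨hv.1, (hv.2.2.resolve_left h).symm, .inr this⟩
  · intro v hv w hw h
    simp only [Finset.mem_coe, mem_closers, Closes] at hv hw
    have := hv.2.1.ne
    have := hw.2.1.ne
    grind

theorem card_closers_swap (hki : k ≠ i) (hji : j ≠ i) :
    (closers G i k j).card = (closers G i j k).card :=
  (card_closers_swap_le hji hki).antisymm (card_closers_swap_le hki hji)

open Classical in
theorem insert_closers_subset (hij : G.Adj i j) :
    insert i (closers G i j k) ⊆ G.neighborFinset j := by
  intro v hv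
  rcases Finset.mem_insert.1 hv with rfl | hv
  · simpa using hij.symm
  · simpa using (mem_closers.1 hv).2.1

open Classical in
theorem card_insert_closers : (insert i (closers G i j k)).card = (closers G i j k).card + 1 :=
  Finset.card_insert_of_notMem fun h => (mem_closers.1 h).1 rfl

open Classical in
theorem degreeBound_le (hG : TwoConnected G) (hij : G.Adj i j) (hik : G.Adj i k) (v : V) :
    degreeBound G i j k v ≤ G.degree v := by
  unfold degreeBound
  split_ifs with h
  · rcases h with rfl | rfl
    · rw [← card_insert_closers, ← G.card_neighborFinset_eq_degree]
      exact Finset.card_le_card (insert_closers_subset hij)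
    · rw [← card_closers_swap hik.ne' hij.ne', ← card_insert_closers,
        ← G.card_neighborFinset_eq_degree]
      exact Finset.card_le_card (insert_closers_subset hik)
  · exact hG.two_le_degree v

open Classical in
theorem two_mul_cyc (hG : TwoConnected G) :
    2 * cyc G = (∑ v, G.degree v : ℕ) + 2 - 2 * (Fintype.card V : ℤ) := by
  have : G.edgeSet.ncard = G.edgeFinset.card := by
    rw [← coe_edgeFinset, Set.ncard_coe_finset]
  rw [cyc_eq_of_connected hG.1, sum_degrees_eq_twice_card_edges, this, Nat.card_eq_fintype_card]
  push_cast
  ring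

theorem card_closers_le_cyc (hG : TwoConnected G) (hij : G.Adj i j) (hik : G.Adj i k)
    (hjk : j ≠ k) : ((closers G i j k).card : ℤ) ≤ cyc G := by
  classical
  have h₁ := two_mul_cyc hG
  have h₂ := sum_degreeBound (G := G) (i := i) hjk
  have h₃ := Finset.sum_le_sum fun v (_ : v ∈ Finset.univ) => degreeBound_le hG hij hik v
  omega

open Classical in
theorem card_closers_eq_cyc_iff (hG : TwoConnected G) (hij : G.Adj i j) (hik : G.Adj i k)
    (hjk : j ≠ k) :
    ((closers G i j k).card : ℤ) = cyc G ↔ ∀ v, G.degree v = degreeBound G i j k v := by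
  have h₁ := two_mul_cyc hG
  have h₂ := sum_degreeBound (G := G) (i := i) hjk
  have h₃ := Finset.sum_eq_sum_iff_of_le fun v (_ : v ∈ Finset.univ) =>
    degreeBound_le hG hij hik v
  simp only [Finset.mem_univ, forall_const] at h₃
  simp only [eq_comm (b := degreeBound _ _ _ _ _), ← h₃]
  omega

theorem card_closers_eq_cyc_iff_edges (hG : TwoConnected G) (hij : G.Adj i j) (hik : G.Adj i k)
    (hjk : j ≠ k) (hdeg : ∀ l, G.Adj i l → l = j ∨ l = k) :
    ((closers G i j k).Nonempty ∧ ((closers G i j k).card : ℤ) = cyc G) ↔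
      ∀ e' ∈ G.edgeSet, InShort G i j k e' := by
  classical
  rw [card_closers_eq_cyc_iff hG hij hik hjk]
  have hji := hij.ne'
  have hki := hik.ne'
  constructor
  · rintro ⟨⟨l₀, hl₀⟩, hd⟩
    rw [mem_closers] at hl₀
    have hj : ∀ v, G.Adj j v → v ≠ i → Closes G i j k v := by
      have := Finset.eq_of_subset_of_card_le (insert_closers_subset (k := k) hij) (by
        rw [card_insert_closers, G.card_neighborFinset_eq_degree, hd, degreeBound,
          if_pos (.inl rfl)])
      intro v hv hvi
      rw [← mem_neighborFinset, ← this, Finset.mem_insert] at hv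
      exact mem_closers.1 (hv.resolve_left hvi)
    have hk : ∀ v, G.Adj k v → v ≠ i → Closes G i k j v := by
      have := Finset.eq_of_subset_of_card_le (insert_closers_subset (k := j) hik) (by
        rw [card_insert_closers, G.card_neighborFinset_eq_degree, hd, degreeBound,
          if_pos (.inr rfl), card_closers_swap hki hji])
      intro v hv hvi
      rw [← mem_neighborFinset, ← this, Finset.mem_insert] at hv
      exact mem_closers.1 (hv.resolve_left hvi)
    have hl : ∀ v w, Closes G i j k v → v ≠ k → G.Adj v w → w = j ∨ w = k := by
      intro v w hv hvk hvw
      have hs : {j, k} ⊆ G.neighborFinset v := by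
        intro x hx
        simp only [Finset.mem_insert, Finset.mem_singleton] at hx
        rcases hx with rfl | rfl
        · simpa using hv.2.1.symm
        · simpa using hv.2.2.resolve_left hvk
      have := Finset.eq_of_subset_of_card_le hs (by
        rw [Finset.card_pair hjk, G.card_neighborFinset_eq_degree, hd, degreeBound,
          if_neg (by simp [hvk, hv.2.1.ne'])])
      rw [← mem_neighborFinset, ← this] at hvw
      simpa using hvw
    have hall : ∀ v, v = i ∨ v = j ∨ v = k ∨ Closes G i j k v := by
      intro v
      have := (reachable_iff_reflTransGen i v).1 (hG.1.preconnected i v)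
      induction this with
      | refl => exact .inl rfl
      | @tail a b _ hab ih =>
        by_cases hbi : b = i
        · exact .inl hbi
        by_cases hak : a = k
        · subst hak
          rcases hk b hab hbi with ⟨_, _, h⟩
          rcases h with rfl | h
          · exact .inr (.inl rfl)
          · exact .inr (.inr (.inr ⟨hbi, h.symm, .inr hab.symm⟩))
        rcases ih with rfl | rfl | h | h
        · rcases hdeg b hab with rfl | rfl <;> simp
        · exact .inr (.inr (.inr (hj b hab hbi)))
        · exact absurd h hak
        · rcases hl a b h hak hab with rfl | rfl <;> simp
    intro e' he'
    induction e' with | _ a b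
    rw [mem_edgeSet] at he'
    have hfj : ∀ b, G.Adj j b → InShort G i j k s(j, b) := by
      intro b hb
      by_cases hbi : b = i
      · subst hbi; exact ⟨l₀, hl₀, .inl Sym2.eq_swap⟩
      · exact ⟨b, hj b hb hbi, .inr (.inr (.inl rfl))⟩
    have hfk : ∀ b, G.Adj k b → InShort G i j k s(k, b) := by
      intro b hb
      by_cases hbi : b = i
      · subst hbi; exact ⟨l₀, hl₀, .inr (.inl Sym2.eq_swap)⟩
      · obtain ⟨-, -, h⟩ := hk b hb hbi
        rcases h with rfl | h
        · exact ⟨k, ⟨hki, hb.symm, .inl rfl⟩, .inr (.inr (.inl Sym2.eq_swap))⟩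
        · exact ⟨b, ⟨hbi, h.symm, .inr hb.symm⟩, .inr (.inr (.inr ⟨hb.ne', Sym2.eq_swap⟩))⟩
    have hor : a = j ∨ a = k ∨ b = j ∨ b = k := by
      rcases hall a with rfl | rfl | rfl | h
      · exact .inr (.inr (hdeg b he'))
      · exact .inl rfl
      · exact .inr (.inl rfl)
      · by_cases hak : a = k
        · exact .inr (.inl hak)
        · exact .inr (.inr (hl a b h hak he'))
    rcases hor with rfl | rfl | rfl | rfl
    · exact hfj b he'
    · exact hfk b he'
    · rw [Sym2.eq_swap]; exact hfj a he'.symm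
    · rw [Sym2.eq_swap]; exact hfk a he'.symm
  · intro h
    constructor
    · obtain ⟨l, hl, -⟩ := h s(i, j) hij
      exact ⟨l, mem_closers.2 hl⟩
    · intro v
      refine le_antisymm ?_ (degreeBound_le hG hij hik v)
      have key : ∀ a b, G.Adj a b → InShort G i j k s(a, b) := fun a b hab => h s(a, b) hab
      unfold degreeBound
      split_ifs with hv
      · rcases hv with rfl | rfl
        · rw [← card_insert_closers, ← G.card_neighborFinset_eq_degree]
          refine Finset.card_le_card fun b hb => ?_
          rw [mem_neighborFinset] at hb
          obtain ⟨l, hl, h'⟩ := key _ _ hb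
          have := hl.2.1.ne
          simp only [Sym2.eq_iff] at h'
          rw [Finset.mem_insert, mem_closers]
          grind
        · rw [← card_closers_swap hki hji, ← card_insert_closers,
            ← G.card_neighborFinset_eq_degree]
          refine Finset.card_le_card fun b hb => ?_
          rw [mem_neighborFinset] at hb
          obtain ⟨l, ⟨hli, hjl, hlk⟩, h'⟩ := key _ _ hb
          have := hjl.symm
          simp only [Sym2.eq_iff] at h'
          rw [Finset.mem_insert, mem_closers, Closes]
          grind
      · rw [← G.card_neighborFinset_eq_degree, ← Finset.card_pair hjk]
        refine Finset.card_le_card fun b hb => ?_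
        rw [mem_neighborFinset] at hb
        obtain ⟨l, hl, h'⟩ := key _ _ hb
        simp only [Sym2.eq_iff] at h'
        simp only [Finset.mem_insert, Finset.mem_singleton]
        grind

end Counting

end Arcs

open Filter in
theorem stmt4 {n : ℕ} (G : SimpleGraph (Fin n)) (hG : TwoConnected G)
    (i j k : Fin n) (hij : G.Adj i j) (hik : G.Adj i k) (hjk : j ≠ k)
    (hdeg : ∀ l, G.Adj i l → l = j ∨ l = k)
    (elt : Sym2 (Fin n) → Sym2 (Fin n) → Prop)
    (hord : IsStrictTotalOrder (Sym2 (Fin n)) elt)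
    (hmax : ∀ e' ∈ G.edgeSet, e' ≠ s(i, j) → elt e' s(i, j))
    (hsecond : ∀ e' ∈ G.edgeSet, e' ≠ s(i, j) → e' ≠ s(i, k) → elt e' s(i, k)) :
    gammaTwo (G.deleteEdges {s(i, j)}) elt ≤ gammaTwo G elt ∧
      (gammaTwo G elt = gammaTwo (G.deleteEdges {s(i, j)}) elt ↔
        ∀ e' ∈ G.edgeSet, ∃ (u : Fin n) (w : G.Walk u u),
          w.IsCycle ∧ (w.length = 3 ∨ w.length = 4) ∧ e' ∈ w.edges ∧ s(i, j) ∈ w.edges) := by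
  simp only [exists_short_cycle_iff hij hik hjk hdeg]
  rw [← card_closers_eq_cyc_iff_edges hG hij hik hjk hdeg]
  have hc : cyc (G.deleteEdges {s(i, j)}) = cyc G - 1 := by
    have hm := Set.ncard_sdiff_singleton_add_one (s := G.edgeSet) (a := s(i, j)) hij (Set.toFinite _)
    rw [cyc_eq_of_connected hG.1, cyc_eq_of_connected (hG.connected_deleteEdge hik hjk),
      edgeSet_deleteEdges, ← hm]
    push_cast
    ring
  have hle := card_closers_le_cyc hG hij hik hjk
  have hn := n1_eq_add hij hik hjk hdeg elt hord hmax hsecond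
  have hdiff : gammaTwo G elt - gammaTwo (G.deleteEdges {s(i, j)}) elt =
      4 * cyc G + 2 - (4 * (closers G i j k).card +
        if (closers G i j k).Nonempty then 2 else 0) := by
    unfold gammaTwo
    rw [hn, hc]
    push_cast
    ring
  split_ifs at hdiff with h
  · simp only [h, true_and]
    omega
  · simp only [h, false_and, iff_false]
    rw [Finset.not_nonempty_iff_eq_empty] at h
    simp only [h, Finset.card_empty] at hdiff hle
    omega

end SEP
end
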